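/- The primitive elements of the subcoalgebras Ū₊ and Ū₋ of Ū = U/K⁺U are exactly P(Ū₊) = span{E_{β'} : β' ∈ Φ⁺_r} and P(Ū₋) = span{F_β : β ∈ Φ⁺_r}. -/

import Mathlib

noncomputable section

open scoped TensorProduct

/-- Cartan integers of `sl_N`. -/
def cartanSL (i j : ℕ) : ℤ :=
  if i = j then 2 else if ((i : ℤ) - j).natAbs = 1 then -1 else 0

/-- The defining relations of `U_q(sl_N)` for a candidate family of generators. -/
def UqslRels (q : ℝ) (N : ℕ) {V : Type} [Ring V] [Algebra ℂ V]
    (e f kg ki : ℕ → V) : Prop :=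
  (∀ i ∈ Finset.Icc 1 (N - 1), kg i * ki i = 1 ∧ ki i * kg i = 1) ∧
  (∀ i ∈ Finset.Icc 1 (N - 1), ∀ j ∈ Finset.Icc 1 (N - 1),
      kg i * kg j = kg j * kg i) ∧
  (∀ i ∈ Finset.Icc 1 (N - 1), ∀ j ∈ Finset.Icc 1 (N - 1),
      kg i * e j = ((q : ℂ) ^ (cartanSL i j)) • (e j * kg i)) ∧
  (∀ i ∈ Finset.Icc 1 (N - 1), ∀ j ∈ Finset.Icc 1 (N - 1),
      kg i * f j = ((q : ℂ) ^ (-cartanSL i j)) • (f j * kg i)) ∧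
  (∀ i ∈ Finset.Icc 1 (N - 1), ∀ j ∈ Finset.Icc 1 (N - 1),
      e i * f j - f j * e i =
        if i = j then (((q : ℂ) - (q : ℂ)⁻¹)⁻¹) • (kg i - ki i) else 0) ∧
  (∀ i ∈ Finset.Icc 1 (N - 1), ∀ j ∈ Finset.Icc 1 (N - 1), ((i : ℤ) - j).natAbs = 1 →
      e i * e i * e j - ((q : ℂ) + (q : ℂ)⁻¹) • (e i * e j * e i) + e j * e i * e i = 0) ∧
  (∀ i ∈ Finset.Icc 1 (N - 1), ∀ j ∈ Finset.Icc 1 (N - 1), 2 ≤ ((i : ℤ) - j).natAbs →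
      e i * e j = e j * e i) ∧
  (∀ i ∈ Finset.Icc 1 (N - 1), ∀ j ∈ Finset.Icc 1 (N - 1), ((i : ℤ) - j).natAbs = 1 →
      f i * f i * f j - ((q : ℂ) + (q : ℂ)⁻¹) • (f i * f j * f i) + f j * f i * f i = 0) ∧
  (∀ i ∈ Finset.Icc 1 (N - 1), ∀ j ∈ Finset.Icc 1 (N - 1), 2 ≤ ((i : ℤ) - j).natAbs →
      f i * f j = f j * f i)

/-- The quantized enveloping algebra `U_q(sl_N)` together with its Hopf algebra
structure, generators, defining relations and universal property. -/
structure UqslData (q : ℝ) (N : ℕ) where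
  U : Type
  [instRing : Ring U]
  [instHopf : HopfAlgebra ℂ U]
  E : ℕ → U
  F : ℕ → U
  Kg : ℕ → U
  Ki : ℕ → U
  rels : UqslRels q N E F Kg Ki
  comul_E : ∀ i ∈ Finset.Icc 1 (N - 1),
    Coalgebra.comul (R := ℂ) (E i) = E i ⊗ₜ[ℂ] 1 + Kg i ⊗ₜ[ℂ] E i
  comul_F : ∀ i ∈ Finset.Icc 1 (N - 1),
    Coalgebra.comul (R := ℂ) (F i) = F i ⊗ₜ[ℂ] Ki i + 1 ⊗ₜ[ℂ] F i
  comul_Kg : ∀ i ∈ Finset.Icc 1 (N - 1),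
    Coalgebra.comul (R := ℂ) (Kg i) = Kg i ⊗ₜ[ℂ] Kg i
  comul_Ki : ∀ i ∈ Finset.Icc 1 (N - 1),
    Coalgebra.comul (R := ℂ) (Ki i) = Ki i ⊗ₜ[ℂ] Ki i
  counit_E : ∀ i ∈ Finset.Icc 1 (N - 1), Coalgebra.counit (R := ℂ) (E i) = 0
  counit_F : ∀ i ∈ Finset.Icc 1 (N - 1), Coalgebra.counit (R := ℂ) (F i) = 0
  counit_Kg : ∀ i ∈ Finset.Icc 1 (N - 1), Coalgebra.counit (R := ℂ) (Kg i) = 1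
  counit_Ki : ∀ i ∈ Finset.Icc 1 (N - 1), Coalgebra.counit (R := ℂ) (Ki i) = 1
  gen : Algebra.adjoin ℂ
      {x : U | ∃ i ∈ Finset.Icc 1 (N - 1), x = E i ∨ x = F i ∨ x = Kg i ∨ x = Ki i} = ⊤
  univ : ∀ (V : Type) [Ring V] [Algebra ℂ V] (e f kg ki : ℕ → V),
      UqslRels q N e f kg ki → ∃ φ : U →ₐ[ℂ] V,
        ∀ i ∈ Finset.Icc 1 (N - 1),
          φ (E i) = e i ∧ φ (F i) = f i ∧ φ (Kg i) = kg i ∧ φ (Ki i) = ki i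

attribute [instance] UqslData.instRing UqslData.instHopf

namespace UqslData

variable {q : ℝ} {N : ℕ} (D : UqslData q N)

/-- Root vectors `E_{α_{i,i+d}}` (iterated `q`-commutators with respect to the
standard reduced decomposition of the longest Weyl group element). -/
def Ev : ℕ → ℕ → D.U
  | 0, i => D.E i
  | d + 1, i => D.E i * Ev d (i + 1) - (q : ℂ)⁻¹ • (Ev d (i + 1) * D.E i)

/-- Root vectors `F_{α_{i,i+d}}`. -/
def Fv : ℕ → ℕ → D.U
  | 0, i => D.F i
  | d + 1, i => Fv d (i + 1) * D.F i - (q : ℂ)⁻¹ • (D.F i * Fv d (i + 1))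

/-- The Hopf subalgebra `K` generated by `E_i, F_i (i ≠ r)` and all `K_j^{±1}`. -/
def Ksub (r : ℕ) : Subalgebra ℂ D.U :=
  Algebra.adjoin ℂ
    ({x : D.U | ∃ i ∈ Finset.Icc 1 (N - 1), i ≠ r ∧ (x = D.E i ∨ x = D.F i)} ∪
     {x : D.U | ∃ j ∈ Finset.Icc 1 (N - 1), x = D.Kg j ∨ x = D.Ki j})

/-- The subspace `K⁺U ⊆ U`. -/
def Jsub (r : ℕ) : Submodule ℂ D.U :=
  Submodule.span ℂ
    {x : D.U | ∃ k ∈ D.Ksub r, Coalgebra.counit (R := ℂ) k = 0 ∧ ∃ u : D.U, x = k * u}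

/-- The subspace `K⁺U ⊗ U + U ⊗ K⁺U` of `U ⊗ U`, i.e. the kernel of `π ⊗ π` where
`π : U → U/K⁺U` is the canonical projection. -/
def JUU (r : ℕ) : Submodule ℂ (D.U ⊗[ℂ] D.U) :=
  LinearMap.range (TensorProduct.map (D.Jsub r).subtype LinearMap.id) ⊔
  LinearMap.range (TensorProduct.map LinearMap.id (D.Jsub r).subtype)

/-- `x ∈ U` represents a primitive element of the quotient coalgebra `Ū = U/K⁺U`. -/
def IsPrimitiveMod (r : ℕ) (x : D.U) : Prop :=
  Coalgebra.comul (R := ℂ) x - x ⊗ₜ[ℂ] 1 - 1 ⊗ₜ[ℂ] x ∈ D.JUU r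

end UqslData

/-- Membership of the pair `(i,j)` in (the index set of) `Φ⁺_r`, the set of positive
roots `α_{ij} = α_i + ⋯ + α_j` of `sl_N` with `i ≤ r ≤ j`. -/
def inPhiR (N r : ℕ) (p : ℕ × ℕ) : Prop :=
  1 ≤ p.1 ∧ p.1 ≤ r ∧ r ≤ p.2 ∧ p.2 ≤ N - 1


/-- The linear map `x ↦ Δ(x) - x ⊗ 1 - 1 ⊗ x` measuring the failure of primitivity. -/
noncomputable def primDefect {q : ℝ} {N : ℕ} (D : UqslData q N) :
    D.U →ₗ[ℂ] D.U ⊗[ℂ] D.U :=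
  Coalgebra.comul (R := ℂ) - (TensorProduct.mk ℂ D.U D.U).flip 1 -
    TensorProduct.mk ℂ D.U D.U 1

/-- The set of root vectors `E_{β'}`, `β' ∈ Φ⁺_r`. -/
def EvSet {q : ℝ} {N : ℕ} (D : UqslData q N) (r : ℕ) : Set D.U :=
  {x : D.U | ∃ p : ℕ × ℕ, inPhiR N r p ∧ x = D.Ev (p.2 - p.1) p.1}

/-- The set of root vectors `F_β`, `β ∈ Φ⁺_r`. -/
def FvSet {q : ℝ} {N : ℕ} (D : UqslData q N) (r : ℕ) : Set D.U :=
  {x : D.U | ∃ p : ℕ × ℕ, inPhiR N r p ∧ x = D.Fv (p.2 - p.1) p.1}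

/-- The subring of `ℂ` of values at `q` of rational functions regular at `1`. -/
def regularAtOne (q : ℝ) : Subring ℂ where
  carrier := {z | ∃ f g : Polynomial ℚ, g.eval 1 ≠ 0 ∧
    z * Polynomial.aeval (q : ℂ) g = Polynomial.aeval (q : ℂ) f}
  mul_mem' := by
    rintro a b ⟨f, g, hg, h⟩ ⟨f', g', hg', h'⟩
    refine ⟨f * f', g * g', by simp [hg, hg'], ?_⟩
    rw [map_mul, map_mul, ← h, ← h']; ring
  one_mem' := ⟨1, 1, by simp, by simp⟩
  add_mem' := by
    rintro a b ⟨f, g, hg, h⟩ ⟨f', g', hg', h'⟩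
    refine ⟨f * g' + f' * g, g * g', by simp [hg, hg'], ?_⟩
    rw [map_mul, map_add, map_mul, map_mul, ← h, ← h']; ring
  zero_mem' := ⟨0, 1, by simp, by simp⟩
  neg_mem' := by
    rintro a ⟨f, g, hg, h⟩
    exact ⟨-f, g, hg, by rw [map_neg, ← h]; ring⟩

lemma self_mem_regularAtOne (q : ℝ) : (q : ℂ) ∈ regularAtOne q :=
  ⟨Polynomial.X, 1, by simp, by simp⟩

section regularAtOne

variable {q : ℝ} (hq : Transcendental ℚ q)
include hq

lemma aeval_ne_zero_of_eval_one_ne_zero {g : Polynomial ℚ} (hg : g.eval 1 ≠ 0) :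
    Polynomial.aeval (q : ℂ) g ≠ 0 := by
  have h : Transcendental ℚ (algebraMap ℝ ℂ q) :=
    (transcendental_algebraMap_iff (algebraMap ℝ ℂ).injective).2 hq
  intro h0
  have := transcendental_iff.1 h g h0
  simp [this] at hg

lemma inv_mem_regularAtOne {f g : Polynomial ℚ} (hf : f.eval 1 ≠ 0) {z : ℂ}
    (h : z * Polynomial.aeval (q : ℂ) g = Polynomial.aeval (q : ℂ) f) :
    z ≠ 0 ∧ z⁻¹ ∈ regularAtOne q := by
  have hz : z ≠ 0 := by
    rintro rfl
    exact aeval_ne_zero_of_eval_one_ne_zero hq hf (by rw [← h, zero_mul])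
  exact ⟨hz, g, f, hf, by rw [← h, inv_mul_cancel_left₀ hz]⟩

lemma base_ne_zero : (q : ℂ) ≠ 0 :=
  (inv_mem_regularAtOne hq (f := Polynomial.X) (g := 1) (by simp) (by simp)).1

lemma zpow_mem_regularAtOne (n : ℤ) : (q : ℂ) ^ n ∈ regularAtOne q := by
  have hi : (q : ℂ)⁻¹ ∈ regularAtOne q :=
    (inv_mem_regularAtOne hq (f := Polynomial.X) (g := 1) (by simp) (by simp)).2
  cases n with
  | ofNat n => simpa using pow_mem (self_mem_regularAtOne q) n
  | negSucc n => simpa [zpow_negSucc] using pow_mem hi (n + 1)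

lemma exists_zpow_sub_one_eq (n : ℤ) :
    ∃ a ∈ regularAtOne q, (q : ℂ) ^ n - 1 = ((q : ℂ) - 1) * a := by
  have h0 := base_ne_zero hq
  induction n using Int.induction_on with
  | zero => exact ⟨0, zero_mem _, by simp⟩
  | succ n ih =>
    obtain ⟨a, ha, h⟩ := ih
    refine ⟨a + (q : ℂ) ^ (n : ℤ), add_mem ha (zpow_mem_regularAtOne hq _), ?_⟩
    rw [mul_add, ← h, zpow_add_one₀ h0]; ring
  | pred n ih =>
    obtain ⟨a, ha, h⟩ := ih
    refine ⟨a - (q : ℂ) ^ (-(n : ℤ) - 1), sub_mem ha (zpow_mem_regularAtOne hq _), ?_⟩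
    rw [mul_sub, ← h, zpow_sub_one₀ h0]; field_simp; ring

/-- Nakayama's lemma over the local ring of rational functions regular at `1`: an operator
which is congruent modulo `q - 1` to a diagonal operator with positive integer eigenvalues
is injective. -/
lemma eq_zero_of_congr_diagonal {V : Type*} [AddCommGroup V] [Module ℂ V] (T : V →ₗ[ℂ] V)
    (S : Set V) (hS : S.Finite)
    (h : ∀ s ∈ S, ∃ m : ℕ, 0 < m ∧ ∃ y ∈ Submodule.span (regularAtOne q) S,
      T s - (m : ℂ) • s = ((q : ℂ) - 1) • y) :
    ∀ x ∈ Submodule.span ℂ S, T x = 0 → x = 0 := by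
  set A := regularAtOne q
  set L := Submodule.span A S with hL
  let π : A := ⟨(q : ℂ) - 1, sub_mem (self_mem_regularAtOne q) (one_mem _)⟩
  have hLW : ∀ y ∈ L, y ∈ Submodule.span ℂ S := by
    intro y hy
    exact Submodule.span_subset_span A ℂ S hy
  have hjac : Ideal.span {π} ≤ Ideal.jacobson (⊥ : Ideal A) := by
    rw [Ideal.span_le, Set.singleton_subset_iff]
    refine Ideal.mem_jacobson_bot.2 ?_
    rintro ⟨y, f, g, hg, hy⟩
    have key := inv_mem_regularAtOne hq (z := ((q : ℂ) - 1) * y + 1)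
      (f := (Polynomial.X - 1) * f + g) (g := g) (by simpa using hg)
      (by simp [← hy]; ring)
    refine IsUnit.of_mul_eq_one ⟨_, key.2⟩ (Subtype.ext ?_)
    exact mul_inv_cancel₀ key.1
  let T' : V →ₗ[A] V := T.restrictScalars A
  have hle : L ≤ L.map T' := by
    refine Submodule.le_of_le_smul_of_le_jacobson_bot (Submodule.fg_span hS) hjac ?_
    rw [Submodule.span_le]
    intro s hs
    obtain ⟨m, hm, y, hy, e⟩ := h s hs
    have hmi : ((m : ℂ))⁻¹ ∈ A :=
      (inv_mem_regularAtOne hq (z := (m : ℂ)) (f := (m : Polynomial ℚ)) (g := 1)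
        (by simp; omega) (by simp)).2
    have hm0 : (m : ℂ) ≠ 0 := by exact_mod_cast hm.ne'
    have e2 : s = (⟨_, hmi⟩ : A) • T' s + π • ((-⟨_, hmi⟩ : A) • y) := by
      change s = (m : ℂ)⁻¹ • T s + ((q : ℂ) - 1) • ((-(m : ℂ)⁻¹) • y)
      rw [smul_comm, ← e, smul_sub, smul_smul (-(m : ℂ)⁻¹), neg_mul, inv_mul_cancel₀ hm0]
      module
    rw [e2]
    refine add_mem (Submodule.mem_sup_left ?_) (Submodule.mem_sup_right ?_)
    · exact Submodule.smul_mem _ _ (Submodule.mem_map_of_mem (Submodule.subset_span hs))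
    · exact Submodule.smul_mem_smul (Ideal.mem_span_singleton_self π)
        (Submodule.smul_mem _ _ hy)
  have hTW : ∀ x ∈ Submodule.span ℂ S, T x ∈ Submodule.span ℂ S := by
    intro x hx
    suffices hle : Submodule.span ℂ S ≤ (Submodule.span ℂ S).comap T from hle hx
    rw [Submodule.span_le]
    intro s hs
    obtain ⟨m, hm, y, hy, e⟩ := h s hs
    change T s ∈ Submodule.span ℂ S
    rw [sub_eq_iff_eq_add.1 e]
    exact add_mem (Submodule.smul_mem _ _ (hLW y hy))
      (Submodule.smul_mem _ _ (Submodule.subset_span hs))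
  have : FiniteDimensional ℂ (Submodule.span ℂ S) := FiniteDimensional.span_of_finite ℂ hS
  have hsurj : Function.Surjective (T.restrict hTW) := by
    have hle' : Submodule.span ℂ S ≤ (Submodule.span ℂ S).map T := by
      rw [Submodule.span_le]
      intro s hs
      obtain ⟨y, hy, e⟩ := hle (Submodule.subset_span hs)
      exact ⟨y, hLW y hy, e⟩
    rintro ⟨x, hx⟩
    obtain ⟨y, hy, e⟩ := hle' hx
    exact ⟨⟨y, hy⟩, Subtype.ext e⟩
  have hinj := LinearMap.injective_iff_surjective.2 hsurj
  intro x hx hx0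
  have := @hinj ⟨x, hx⟩ 0 (Subtype.ext (by simpa using hx0))
  simpa using this

end regularAtOne

/-- The middle generator commutes with the root vector of `sl_4` attached to the highest root. -/
lemma commute_of_serre {V : Type*} [Ring V] [Algebra ℂ V] {c : ℂ} (h0 : c ≠ 0)
    (h1 : c + c⁻¹ ≠ 0) {x y z : V} (hxz : x * z = z * x)
    (hyx : y * y * x - (c + c⁻¹) • (y * x * y) + x * y * y = 0)
    (hyz : y * y * z - (c + c⁻¹) • (y * z * y) + z * y * y = 0) :
    Commute (x * (y * z - c⁻¹ • (z * y)) - c⁻¹ • ((y * z - c⁻¹ • (z * y)) * x)) y := by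
  obtain ⟨u, hu⟩ : ∃ u, u = x * y - c⁻¹ • (y * x) := ⟨_, rfl⟩
  obtain ⟨v, hv⟩ : ∃ v, v = y * z - c⁻¹ • (z * y) := ⟨_, rfl⟩
  obtain ⟨w, hw⟩ : ∃ w, w = x * v - c⁻¹ • (v * x) := ⟨_, rfl⟩
  have hw' : w = u * z - c⁻¹ • (z * u) := by
    rw [hw, hu, hv]
    have a1 : x * (z * y) = z * (x * y) := by rw [← mul_assoc, hxz, mul_assoc]
    simp only [mul_sub, sub_mul, mul_smul_comm, smul_mul_assoc, smul_sub, mul_assoc]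
    rw [a1, ← hxz]
    module
  have huy : u * y = c • (y * u) := by
    rw [← sub_eq_zero, ← hyx, hu]
    simp only [mul_sub, sub_mul, mul_smul_comm, smul_mul_assoc, smul_sub, smul_smul,
      mul_inv_cancel₀ h0, mul_assoc]
    module
  have hyv : y * v = c • (v * y) := by
    rw [← sub_eq_zero, ← hyz, hv]
    simp only [mul_sub, sub_mul, mul_smul_comm, smul_mul_assoc, smul_sub, smul_smul,
      mul_inv_cancel₀ h0, mul_assoc]
    module
  have hxy : x * y = u + c⁻¹ • (y * x) := by rw [hu]; abel
  have hzy : z * y = c • (y * z - v) := by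
    rw [hv, smul_sub, smul_sub, smul_smul, mul_inv_cancel₀ h0]; module
  have hvy : v * y = c⁻¹ • (y * v) := by rw [hyv, smul_smul, inv_mul_cancel₀ h0, one_smul]
  have hyu : y * u = c⁻¹ • (u * y) := by rw [huy, smul_smul, inv_mul_cancel₀ h0, one_smul]
  have e1 : w * y = c ^ 2 • (y * w) - c • (u * v - v * u) := by
    have : w * y = u * (z * y) - z * y * u := by
      rw [hw', sub_mul, smul_mul_assoc, mul_assoc, mul_assoc z, huy, mul_smul_comm, smul_smul,
        inv_mul_cancel₀ h0, one_smul, mul_assoc]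
    rw [this, hzy, hw', mul_smul_comm, mul_sub, ← mul_assoc u y z, huy]
    simp only [mul_sub, sub_mul, mul_smul_comm, smul_mul_assoc, smul_sub, smul_smul, mul_assoc]
    rw [show c ^ 2 * c⁻¹ = c by field_simp]
    module
  have e2 : w * y = (c⁻¹) ^ 2 • (y * w) + c⁻¹ • (u * v - v * u) := by
    have : w * y = c⁻¹ • (x * y * v) - c⁻¹ • (v * (x * y)) := by
      rw [hw, sub_mul, smul_mul_assoc, mul_assoc, hvy, mul_smul_comm, mul_assoc, mul_assoc]
    rw [this, hxy, hw, mul_add, mul_smul_comm, ← mul_assoc v y x, hvy]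
    simp only [mul_sub, add_mul, mul_smul_comm, smul_mul_assoc, smul_sub, smul_add, smul_smul,
      mul_assoc]
    module
  have e3 : (c + c⁻¹) • (w * y) = (c + c⁻¹) • (y * w) := by
    have : (c + c⁻¹) • (w * y) = c⁻¹ • (w * y) + c • (w * y) := by module
    rw [this]
    nth_rewrite 1 [e1]
    rw [e2]
    have a1 : c⁻¹ * c ^ 2 = c := by field_simp
    have a2 : c * (c⁻¹) ^ 2 = c⁻¹ := by field_simp
    rw [smul_sub, smul_add, smul_smul, smul_smul, smul_smul, smul_smul, a1, a2,
      mul_comm c⁻¹ c]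
    module
  have := smul_right_injective V h1 e3
  rw [← hv, ← hw]
  exact this

namespace UqslData

variable {q : ℝ} {N : ℕ} (D : UqslData q N)

section Relations

variable {D}

lemma E_mul_E_of_far {i j : ℕ} (hi : i ∈ Finset.Icc 1 (N - 1)) (hj : j ∈ Finset.Icc 1 (N - 1))
    (h : i + 2 ≤ j ∨ j + 2 ≤ i) : Commute (D.E i) (D.E j) :=
  D.rels.2.2.2.2.2.2.1 i hi j hj (by omega)

lemma serre_E {i j : ℕ} (hi : i ∈ Finset.Icc 1 (N - 1)) (hj : j ∈ Finset.Icc 1 (N - 1))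
    (h : i + 1 = j ∨ j + 1 = i) :
    D.E i * D.E i * D.E j - ((q : ℂ) + (q : ℂ)⁻¹) • (D.E i * D.E j * D.E i)
      + D.E j * D.E i * D.E i = 0 :=
  D.rels.2.2.2.2.2.1 i hi j hj (by omega)

lemma commute_of_commute_E_Ev {y : D.U} {d i : ℕ}
    (h : ∀ k, i ≤ k → k ≤ i + d → Commute y (D.E k)) : Commute y (D.Ev d i) := by
  induction d generalizing i with
  | zero => exact h i le_rfl le_rfl
  | succ d ih =>
    have h1 := h i le_rfl (by omega)
    have h2 := ih (i := i + 1) fun k hk hk' => h k (by omega) (by omega)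
    exact (h1.mul_right h2).sub_right ((h2.mul_right h1).smul_right _)

lemma E_commute_Ev_of_far {d i k : ℕ} (hi : 1 ≤ i) (hd : i + d ≤ N - 1)
    (hk : k ∈ Finset.Icc 1 (N - 1)) (h : k + 2 ≤ i ∨ i + d + 2 ≤ k) :
    Commute (D.E k) (D.Ev d i) :=
  commute_of_commute_E_Ev fun l hl hl' =>
    E_mul_E_of_far hk (Finset.mem_Icc.2 ⟨by omega, by omega⟩) (by omega)

lemma Ev_succ_right {d i : ℕ} (hi : 1 ≤ i) (hd : i + d + 1 ≤ N - 1) :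
    D.Ev (d + 1) i =
      D.Ev d i * D.E (i + d + 1) - (q : ℂ)⁻¹ • (D.E (i + d + 1) * D.Ev d i) := by
  induction d generalizing i with
  | zero => rfl
  | succ d ih =>
    have hc : D.E i * D.E (i + (d + 1) + 1) = D.E (i + (d + 1) + 1) * D.E i :=
      E_mul_E_of_far (Finset.mem_Icc.2 ⟨by omega, by omega⟩)
        (Finset.mem_Icc.2 ⟨by omega, by omega⟩) (by omega)
    have ih' := ih (i := i + 1) (by omega) (by omega)
    rw [show i + 1 + d + 1 = i + (d + 1) + 1 by ring] at ih'
    rw [Ev, ih', Ev]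
    have a1 (y : D.U) : D.E i * (D.E (i + (d + 1) + 1) * y) =
        D.E (i + (d + 1) + 1) * (D.E i * y) := by rw [← mul_assoc, hc, mul_assoc]
    simp only [mul_sub, sub_mul, mul_smul_comm, smul_mul_assoc, smul_sub, mul_assoc]
    rw [a1, ← hc]
    module

lemma E_mul_Ev_left (h0 : (q : ℂ) ≠ 0) {d i : ℕ} (hi : 1 ≤ i) (hd : i + d + 1 ≤ N - 1) :
    D.E i * D.Ev (d + 1) i = (q : ℂ) • (D.Ev (d + 1) i * D.E i) := by
  induction d with
  | zero =>
    have := serre_E (D := D) (i := i) (j := i + 1) (Finset.mem_Icc.2 ⟨by omega, by omega⟩)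
      (Finset.mem_Icc.2 ⟨by omega, by omega⟩) (by omega)
    rw [← sub_eq_zero, ← this, Ev, Ev]
    simp only [mul_sub, sub_mul, mul_smul_comm, smul_mul_assoc, smul_sub, smul_smul,
      mul_inv_cancel₀ h0, mul_assoc]
    module
  | succ d ih =>
    have ih := ih (by omega)
    have hc : D.E i * D.E (i + (d + 1) + 1) = D.E (i + (d + 1) + 1) * D.E i :=
      E_mul_E_of_far (Finset.mem_Icc.2 ⟨by omega, by omega⟩)
        (Finset.mem_Icc.2 ⟨by omega, by omega⟩) (by omega)
    rw [Ev_succ_right hi (by omega)]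
    simp only [mul_sub, sub_mul, mul_smul_comm, smul_mul_assoc, smul_sub]
    rw [← mul_assoc, ih, ← mul_assoc (D.E i) (D.E _), hc, mul_assoc (D.E _) (D.E i), ih,
      mul_assoc _ (D.E _) (D.E i), ← hc]
    simp only [mul_assoc, smul_mul_assoc, mul_smul_comm]
    module

lemma Ev_mul_E_right (h0 : (q : ℂ) ≠ 0) {d i : ℕ} (hi : 1 ≤ i) (hd : i + d + 1 ≤ N - 1) :
    D.Ev (d + 1) i * D.E (i + d + 1) = (q : ℂ) • (D.E (i + d + 1) * D.Ev (d + 1) i) := by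
  induction d generalizing i with
  | zero =>
    have := serre_E (D := D) (i := i + 1) (j := i) (Finset.mem_Icc.2 ⟨by omega, by omega⟩)
      (Finset.mem_Icc.2 ⟨by omega, by omega⟩) (by omega)
    rw [← sub_eq_zero, ← this, Ev, Ev]
    simp only [mul_sub, sub_mul, mul_smul_comm, smul_mul_assoc, smul_sub, smul_smul,
      mul_inv_cancel₀ h0, mul_assoc, add_zero]
    module
  | succ d ih =>
    have ih := ih (i := i + 1) (by omega) (by omega)
    rw [show i + 1 + d + 1 = i + (d + 1) + 1 by ring] at ih
    have hc : D.E i * D.E (i + (d + 1) + 1) = D.E (i + (d + 1) + 1) * D.E i :=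
      E_mul_E_of_far (Finset.mem_Icc.2 ⟨by omega, by omega⟩)
        (Finset.mem_Icc.2 ⟨by omega, by omega⟩) (by omega)
    rw [Ev]
    simp only [mul_sub, sub_mul, mul_smul_comm, smul_mul_assoc, smul_sub]
    rw [mul_assoc, ih, mul_assoc _ (D.E i), hc, ← mul_assoc _ (D.E _) (D.E i), ih,
      ← mul_assoc (D.E _) (D.E i), ← hc]
    simp only [mul_assoc, smul_mul_assoc, mul_smul_comm]
    module

lemma Ev_commute_E_of_inside (h0 : (q : ℂ) ≠ 0) (h1 : (q : ℂ) + (q : ℂ)⁻¹ ≠ 0) {d i k : ℕ}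
    (hi : 1 ≤ i) (hd : i + d ≤ N - 1) (hik : i < k) (hk : k < i + d) :
    Commute (D.Ev d i) (D.E k) := by
  have hmem : ∀ {l}, 1 ≤ l → l ≤ N - 1 → l ∈ Finset.Icc 1 (N - 1) :=
    fun h h' => Finset.mem_Icc.2 ⟨h, h'⟩
  have base : ∀ d, ∀ i, 1 ≤ i → i + (d + 2) ≤ N - 1 →
      Commute (D.Ev (d + 2) i) (D.E (i + 1)) := by
    intro d
    induction d with
    | zero =>
      intro i hi hd
      exact commute_of_serre h0 h1
        (E_mul_E_of_far (hmem (by omega) (by omega)) (hmem (by omega) (by omega)) (by omega))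
        (serre_E (hmem (by omega) (by omega)) (hmem (by omega) (by omega)) (by omega))
        (serre_E (hmem (by omega) (by omega)) (hmem (by omega) (by omega)) (by omega))
    | succ d ih =>
      intro i hi hd
      have hc : Commute (D.E (i + (d + 2) + 1)) (D.E (i + 1)) :=
        E_mul_E_of_far (hmem (by omega) (by omega)) (hmem (by omega) (by omega)) (by omega)
      rw [show d + 1 + 2 = (d + 2) + 1 by ring, Ev_succ_right hi (by omega)]
      have h := ih i hi (by omega)
      exact (h.mul_left hc).sub_left ((hc.mul_left h).smul_left _)
  induction d generalizing i with
  | zero => omega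
  | succ d ih =>
    rcases Nat.eq_or_lt_of_le (Nat.succ_le_of_lt hik) with rfl | hlt
    · obtain ⟨e, rfl⟩ : ∃ e, d = e + 1 := ⟨d - 1, by omega⟩
      exact base e i hi hd
    · have h := ih (i := i + 1) (by omega) (by omega) (by omega) (by omega)
      have hc : Commute (D.E i) (D.E k) :=
        E_mul_E_of_far (hmem (by omega) (by omega)) (hmem (by omega) (by omega)) (by omega)
      exact (hc.mul_left h).sub_left ((h.mul_left hc).smul_left _)

lemma E_mul_F_of_ne {i j : ℕ} (hi : i ∈ Finset.Icc 1 (N - 1)) (hj : j ∈ Finset.Icc 1 (N - 1))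
    (h : i ≠ j) : Commute (D.E i) (D.F j) := by
  have := D.rels.2.2.2.2.1 i hi j hj
  rw [if_neg h] at this
  exact sub_eq_zero.1 this

lemma Kg_mul_E {i j : ℕ} (hi : i ∈ Finset.Icc 1 (N - 1)) (hj : j ∈ Finset.Icc 1 (N - 1)) :
    D.Kg i * D.E j = ((q : ℂ) ^ (cartanSL i j)) • (D.E j * D.Kg i) :=
  D.rels.2.2.1 i hi j hj

lemma Kg_mul_Ki {i : ℕ} (hi : i ∈ Finset.Icc 1 (N - 1)) : D.Kg i * D.Ki i = 1 :=
  (D.rels.1 i hi).1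

lemma Ki_mul_Kg {i : ℕ} (hi : i ∈ Finset.Icc 1 (N - 1)) : D.Ki i * D.Kg i = 1 :=
  (D.rels.1 i hi).2

/-- If `Kg i` `q`-commutes with `x`, then `Ki i` `q⁻¹`-commutes with `x`. -/
lemma Ki_mul_of_Kg_mul (h0 : (q : ℂ) ≠ 0) {i : ℕ} (hi : i ∈ Finset.Icc 1 (N - 1)) {x : D.U}
    {n : ℤ} (h : D.Kg i * x = (q : ℂ) ^ n • (x * D.Kg i)) :
    D.Ki i * x = (q : ℂ) ^ (-n) • (x * D.Ki i) := by
  have h2 : x = (q : ℂ) ^ n • (D.Ki i * x * D.Kg i) := by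
    rw [mul_assoc, ← mul_smul_comm, ← h, ← mul_assoc, Ki_mul_Kg hi, one_mul]
  have h3 : x * D.Ki i = (q : ℂ) ^ n • (D.Ki i * x) := by
    nth_rewrite 1 [h2]
    rw [smul_mul_assoc, mul_assoc _ (D.Kg i), Kg_mul_Ki hi, mul_one]
  rw [h3, smul_smul, ← zpow_add₀ h0, neg_add_cancel, zpow_zero, one_smul]

lemma Kg_mul_Ev_of_forall_cartan_eq_zero {d i k : ℕ} (hi : 1 ≤ i) (hd : i + d ≤ N - 1)
    (hk : k ∈ Finset.Icc 1 (N - 1)) (h : k + 2 ≤ i ∨ i + d + 2 ≤ k) :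
    Commute (D.Kg k) (D.Ev d i) := by
  refine commute_of_commute_E_Ev fun l hl hl' => ?_
  have := Kg_mul_E (D := D) hk (Finset.mem_Icc.2 ⟨by omega, by omega⟩ : l ∈ _)
  have hc : cartanSL k l = 0 := by
    rw [cartanSL, if_neg (by omega), if_neg (by omega)]
  rwa [hc, zpow_zero, one_smul] at this

lemma Kg_mul_Ev_of_adjacent {d i k : ℕ} (hi : 1 ≤ i) (hd : i + d ≤ N - 1)
    (hk : k ∈ Finset.Icc 1 (N - 1)) (h : k + 1 = i ∨ k = i + d + 1) :
    D.Kg k * D.Ev d i = (q : ℂ) ^ (-1 : ℤ) • (D.Ev d i * D.Kg k) := by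
  have hadj : ∀ l, l ∈ Finset.Icc 1 (N - 1) → k + 1 = l ∨ l + 1 = k →
      D.Kg k * D.E l = (q : ℂ) ^ (-1 : ℤ) • (D.E l * D.Kg k) := by
    intro l hl hkl
    have := Kg_mul_E (D := D) hk hl
    rwa [show cartanSL k l = -1 by rw [cartanSL, if_neg (by omega), if_pos (by omega)]] at this
  cases d with
  | zero => exact hadj i (Finset.mem_Icc.2 ⟨by omega, by omega⟩) (by omega)
  | succ d =>
    rcases h with h | h
    · have h1 := hadj i (Finset.mem_Icc.2 ⟨by omega, by omega⟩) (by omega)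
      have h2 : D.Kg k * D.Ev d (i + 1) = D.Ev d (i + 1) * D.Kg k :=
        Kg_mul_Ev_of_forall_cartan_eq_zero (by omega) (by omega) hk (by omega)
      rw [Ev, mul_sub, mul_smul_comm, ← mul_assoc, h1, ← mul_assoc, h2, smul_mul_assoc,
        mul_assoc, h2, mul_assoc, h1, sub_mul]
      simp only [mul_smul_comm, smul_mul_assoc, mul_assoc]
      module
    · have h1 := hadj (i + d + 1) (Finset.mem_Icc.2 ⟨by omega, by omega⟩) (by omega)
      have h2 : D.Kg k * D.Ev d i = D.Ev d i * D.Kg k :=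
        Kg_mul_Ev_of_forall_cartan_eq_zero (by omega) (by omega) hk (by omega)
      rw [Ev_succ_right hi (by omega), mul_sub, mul_smul_comm, ← mul_assoc, h2, ← mul_assoc, h1,
        mul_assoc, h1, smul_mul_assoc, mul_assoc, h2, sub_mul]
      simp only [mul_smul_comm, smul_mul_assoc, mul_assoc]
      module

end Relations

end UqslData

namespace UqslData

variable {q : ℝ} {N : ℕ} (D : UqslData q N)

/-- Generators of the augmentation ideal of `K`. -/
def augGens (r : ℕ) : Set D.U :=
  {x | ∃ i ∈ Finset.Icc 1 (N - 1), (i ≠ r ∧ (x = D.E i ∨ x = D.F i)) ∨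
    x = D.Kg i - 1 ∨ x = D.Ki i - 1}

variable {D} {r : ℕ}

lemma mul_mem_Jsub {x : D.U} (hx : x ∈ D.Jsub r) (u : D.U) : x * u ∈ D.Jsub r := by
  induction hx using Submodule.span_induction with
  | mem x hx =>
    obtain ⟨k, hk, hk0, v, rfl⟩ := hx
    exact Submodule.subset_span ⟨k, hk, hk0, v * u, mul_assoc _ _ _⟩
  | zero => simp
  | add x y _ _ hx hy => rw [add_mul]; exact add_mem hx hy
  | smul a x _ hx => rw [smul_mul_assoc]; exact Submodule.smul_mem _ _ hx

lemma mem_Jsub_of_mem_Ksub {k : D.U} (hk : k ∈ D.Ksub r)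
    (hk0 : Coalgebra.counit (R := ℂ) k = 0) : k ∈ D.Jsub r :=
  Submodule.subset_span ⟨k, hk, hk0, 1, (mul_one k).symm⟩

lemma E_mem_Jsub {i : ℕ} (hi : i ∈ Finset.Icc 1 (N - 1)) (h : i ≠ r) : D.E i ∈ D.Jsub r :=
  mem_Jsub_of_mem_Ksub (Algebra.subset_adjoin (Or.inl ⟨i, hi, h, Or.inl rfl⟩)) (D.counit_E i hi)

lemma F_mem_Jsub {i : ℕ} (hi : i ∈ Finset.Icc 1 (N - 1)) (h : i ≠ r) : D.F i ∈ D.Jsub r :=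
  mem_Jsub_of_mem_Ksub (Algebra.subset_adjoin (Or.inl ⟨i, hi, h, Or.inr rfl⟩)) (D.counit_F i hi)

lemma Kg_sub_one_mem_Jsub {i : ℕ} (hi : i ∈ Finset.Icc 1 (N - 1)) :
    D.Kg i - 1 ∈ D.Jsub r :=
  mem_Jsub_of_mem_Ksub
    (sub_mem (Algebra.subset_adjoin (Or.inr ⟨i, hi, Or.inl rfl⟩)) (one_mem _))
    (by rw [map_sub, D.counit_Kg i hi, Bialgebra.counit_one, sub_self])

lemma Ki_sub_one_mem_Jsub {i : ℕ} (hi : i ∈ Finset.Icc 1 (N - 1)) :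
    D.Ki i - 1 ∈ D.Jsub r :=
  mem_Jsub_of_mem_Ksub
    (sub_mem (Algebra.subset_adjoin (Or.inr ⟨i, hi, Or.inr rfl⟩)) (one_mem _))
    (by rw [map_sub, D.counit_Ki i hi, Bialgebra.counit_one, sub_self])

lemma augGens_subset_Jsub : D.augGens r ⊆ D.Jsub r := by
  rintro _ ⟨i, hi, ⟨h, rfl | rfl⟩ | rfl | rfl⟩
  exacts [E_mem_Jsub hi h, F_mem_Jsub hi h, Kg_sub_one_mem_Jsub hi, Ki_sub_one_mem_Jsub hi]

/-- `K⁺U` is the smallest right ideal containing the generators of `K⁺`. -/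
lemma Jsub_le {P : Submodule ℂ D.U} (hmul : ∀ x ∈ P, ∀ u, x * u ∈ P)
    (hgen : ∀ x ∈ D.augGens r, x ∈ P) : D.Jsub r ≤ P := by
  have key : ∀ k ∈ D.Ksub r,
      k - algebraMap ℂ D.U (Coalgebra.counit (R := ℂ) k) ∈ P := by
    intro k hk
    induction hk using Algebra.adjoin_induction with
    | mem x hx =>
      rcases hx with ⟨i, hi, h, rfl | rfl⟩ | ⟨i, hi, rfl | rfl⟩
      · rw [D.counit_E i hi, map_zero, sub_zero]
        exact hgen _ ⟨i, hi, Or.inl ⟨h, Or.inl rfl⟩⟩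
      · rw [D.counit_F i hi, map_zero, sub_zero]
        exact hgen _ ⟨i, hi, Or.inl ⟨h, Or.inr rfl⟩⟩
      · rw [D.counit_Kg i hi, map_one]
        exact hgen _ ⟨i, hi, Or.inr (Or.inl rfl)⟩
      · rw [D.counit_Ki i hi, map_one]
        exact hgen _ ⟨i, hi, Or.inr (Or.inr rfl)⟩
    | algebraMap a => simp
    | add x y _ _ hx hy =>
      rw [map_add, map_add, add_sub_add_comm]
      exact add_mem hx hy
    | mul x y _ _ hx hy =>
      have : x * y - algebraMap ℂ D.U (Coalgebra.counit (R := ℂ) (x * y)) =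
          (x - algebraMap ℂ D.U (Coalgebra.counit (R := ℂ) x)) * y +
          Coalgebra.counit (R := ℂ) x •
            (y - algebraMap ℂ D.U (Coalgebra.counit (R := ℂ) y)) := by
        rw [Bialgebra.counit_mul, map_mul, Algebra.smul_def]
        noncomm_ring
      rw [this]
      exact add_mem (hmul _ hx _) (P.smul_mem _ hy)
  rw [Jsub, Submodule.span_le]
  rintro _ ⟨k, hk, hk0, u, rfl⟩
  have := key k hk
  rw [hk0, map_zero, sub_zero] at this
  exact hmul _ this u

lemma tmul_mem_JUU_left {x : D.U} (hx : x ∈ D.Jsub r) (u : D.U) : x ⊗ₜ[ℂ] u ∈ D.JUU r :=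
  Submodule.mem_sup_left ⟨(⟨x, hx⟩ : D.Jsub r) ⊗ₜ u, rfl⟩

lemma tmul_mem_JUU_right {x : D.U} (hx : x ∈ D.Jsub r) (u : D.U) : u ⊗ₜ[ℂ] x ∈ D.JUU r :=
  Submodule.mem_sup_right ⟨u ⊗ₜ (⟨x, hx⟩ : D.Jsub r), rfl⟩

lemma JUU_le {P : Submodule ℂ (D.U ⊗[ℂ] D.U)}
    (h : ∀ x ∈ D.Jsub r, ∀ u, x ⊗ₜ[ℂ] u ∈ P ∧ u ⊗ₜ[ℂ] x ∈ P) : D.JUU r ≤ P := by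
  refine sup_le ?_ ?_
  · rintro _ ⟨t, rfl⟩
    induction t with
    | zero => simp
    | tmul x u => exact (h x.1 x.2 u).1
    | add a b ha hb => rw [map_add]; exact add_mem ha hb
  · rintro _ ⟨t, rfl⟩
    induction t with
    | zero => simp
    | tmul u x => exact (h x.1 x.2 u).2
    | add a b ha hb => rw [map_add]; exact add_mem ha hb

lemma mul_mem_JUU {t : D.U ⊗[ℂ] D.U} (ht : t ∈ D.JUU r) (s : D.U ⊗[ℂ] D.U) :
    t * s ∈ D.JUU r := by
  suffices h : D.JUU r ≤ (D.JUU r).comap (LinearMap.mulRight ℂ s) from h ht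
  refine JUU_le fun x hx u => ?_
  simp only [Submodule.mem_comap, LinearMap.mulRight_apply]
  induction s with
  | zero => simp
  | tmul a b =>
    simp only [Algebra.TensorProduct.tmul_mul_tmul]
    exact ⟨tmul_mem_JUU_left (mul_mem_Jsub hx _) _, tmul_mem_JUU_right (mul_mem_Jsub hx _) _⟩
  | add a b ha hb =>
    simp only [mul_add]
    exact ⟨add_mem ha.1 hb.1, add_mem ha.2 hb.2⟩

lemma comul_mem_JUU {x : D.U} (hx : x ∈ D.Jsub r) :
    Coalgebra.comul (R := ℂ) x ∈ D.JUU r := by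
  suffices h : D.Jsub r ≤ (D.JUU r).comap (Coalgebra.comul (R := ℂ)) from h hx
  refine Jsub_le (fun x hx u => ?_) ?_
  · simp only [Submodule.mem_comap] at hx ⊢
    rw [Bialgebra.comul_mul]
    exact mul_mem_JUU hx _
  · have hG {g : D.U} (hg : Coalgebra.comul (R := ℂ) g = g ⊗ₜ[ℂ] g) (hJ : g - 1 ∈ D.Jsub r) :
        Coalgebra.comul (R := ℂ) (g - 1) ∈ D.JUU r := by
      have : Coalgebra.comul (R := ℂ) (g - 1) = (g - 1) ⊗ₜ[ℂ] g + 1 ⊗ₜ[ℂ] (g - 1) := by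
        rw [map_sub, hg, Bialgebra.comul_one, TensorProduct.sub_tmul, TensorProduct.tmul_sub,
          Algebra.TensorProduct.one_def]
        abel
      rw [this]
      exact add_mem (tmul_mem_JUU_left hJ _) (tmul_mem_JUU_right hJ _)
    rintro _ ⟨i, hi, ⟨h, rfl | rfl⟩ | rfl | rfl⟩
    · rw [Submodule.mem_comap, D.comul_E i hi]
      exact add_mem (tmul_mem_JUU_left (E_mem_Jsub hi h) _)
        (tmul_mem_JUU_right (E_mem_Jsub hi h) _)
    · rw [Submodule.mem_comap, D.comul_F i hi]
      exact add_mem (tmul_mem_JUU_left (F_mem_Jsub hi h) _)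
        (tmul_mem_JUU_right (F_mem_Jsub hi h) _)
    · exact hG (D.comul_Kg i hi) (Kg_sub_one_mem_Jsub hi)
    · exact hG (D.comul_Ki i hi) (Ki_sub_one_mem_Jsub hi)

lemma primDefect_apply (x : D.U) :
    primDefect D x = Coalgebra.comul (R := ℂ) x - x ⊗ₜ[ℂ] 1 - 1 ⊗ₜ[ℂ] x := rfl

variable (D r) in
/-- Representatives in `U` of the primitive elements of `U/K⁺U`. -/
def primSub : Submodule ℂ D.U := Submodule.comap (primDefect D) (D.JUU r)

lemma Jsub_le_primSub : D.Jsub r ≤ D.primSub r := fun _ hx =>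
  sub_mem (sub_mem (comul_mem_JUU hx) (tmul_mem_JUU_left hx 1)) (tmul_mem_JUU_right hx 1)

lemma E_mem_primSub {i : ℕ} (hi : i ∈ Finset.Icc 1 (N - 1)) : D.E i ∈ D.primSub r := by
  have : primDefect D (D.E i) = (D.Kg i - 1) ⊗ₜ[ℂ] D.E i := by
    rw [primDefect_apply, D.comul_E i hi, TensorProduct.sub_tmul]; abel
  change primDefect D (D.E i) ∈ D.JUU r
  rw [this]
  exact tmul_mem_JUU_left (Kg_sub_one_mem_Jsub hi) _

lemma mul_E_mem_primSub {x : D.U} (hx : x ∈ D.primSub r) {i : ℕ}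
    (hi : i ∈ Finset.Icc 1 (N - 1)) (h : i ≠ r) : x * D.E i ∈ D.primSub r := by
  have : primDefect D (x * D.E i) =
      primDefect D x * (D.E i ⊗ₜ[ℂ] 1 + D.Kg i ⊗ₜ[ℂ] D.E i) + (x * D.Kg i) ⊗ₜ[ℂ] D.E i +
        D.E i ⊗ₜ[ℂ] x + (D.Kg i - 1) ⊗ₜ[ℂ] (x * D.E i) := by
    rw [primDefect_apply, primDefect_apply, Bialgebra.comul_mul, D.comul_E i hi,
      TensorProduct.sub_tmul]
    simp only [sub_mul, mul_add, Algebra.TensorProduct.tmul_mul_tmul, one_mul, mul_one]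
    abel
  change primDefect D (x * D.E i) ∈ D.JUU r
  rw [this]
  exact add_mem (add_mem (add_mem (mul_mem_JUU hx _) (tmul_mem_JUU_right (E_mem_Jsub hi h) _))
    (tmul_mem_JUU_left (E_mem_Jsub hi h) _)) (tmul_mem_JUU_left (Kg_sub_one_mem_Jsub hi) _)

/-- Extending a root vector on the left, modulo `K⁺U`. -/
lemma Ev_succ_left_sub_mem {d i : ℕ} (hi : 1 ≤ i) (hir : i ≠ r) (hd : i ≤ N - 1) :
    D.Ev (d + 1) i - (-(q : ℂ)⁻¹) • (D.Ev d (i + 1) * D.E i) ∈ D.Jsub r := by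
  rw [Ev, neg_smul, sub_neg_eq_add, sub_add_cancel]
  exact mul_mem_Jsub (E_mem_Jsub (Finset.mem_Icc.2 ⟨hi, hd⟩) hir) _

/-- Extending a root vector on the right, modulo `K⁺U`. -/
lemma Ev_succ_right_sub_mem {d i : ℕ} (hi : 1 ≤ i) (hir : i + d + 1 ≠ r)
    (hd : i + d + 1 ≤ N - 1) :
    D.Ev (d + 1) i - D.Ev d i * D.E (i + d + 1) ∈ D.Jsub r := by
  rw [Ev_succ_right hi hd, sub_sub_cancel_left, neg_mem_iff]
  exact Submodule.smul_mem _ _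
    (mul_mem_Jsub (E_mem_Jsub (Finset.mem_Icc.2 ⟨by omega, hd⟩) hir) _)

/-- Induction over the roots of `Φ⁺_r`, starting from `α_r`. -/
lemma phiR_induction {P : ℕ → ℕ → Prop} (h0 : P 0 r)
    (hr : ∀ d i, 1 ≤ i → i ≤ r → r ≤ i + d → i + d + 1 ≤ N - 1 → P d i → P (d + 1) i)
    (hl : ∀ d i, 1 ≤ i → i + 1 ≤ r → r ≤ i + d + 1 → i + d + 1 ≤ N - 1 → P d (i + 1) →
      P (d + 1) i) :
    ∀ d i, 1 ≤ i → i ≤ r → r ≤ i + d → i + d ≤ N - 1 → P d i := by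
  intro d
  induction d with
  | zero =>
    intro i _ h1 h2 _
    obtain rfl : i = r := by omega
    exact h0
  | succ d ih =>
    intro i hi hir hri hd
    rcases Nat.lt_or_ge i r with h | h
    · exact hl d i hi h (by omega) (by omega) (ih (i + 1) (by omega) (by omega) (by omega)
        (by omega))
    · exact hr d i hi hir (by omega) (by omega) (ih i hi hir (by omega) (by omega))

lemma Ev_mem_primSub (hr1 : 1 ≤ r) (hr2 : r ≤ N - 1) : ∀ d i, 1 ≤ i → i ≤ r → r ≤ i + d →
    i + d ≤ N - 1 → D.Ev d i ∈ D.primSub r := by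
  refine phiR_induction (E_mem_primSub (Finset.mem_Icc.2 ⟨hr1, hr2⟩)) ?_ ?_
  · intro d i hi hir hri hd ih
    have h := Jsub_le_primSub (Ev_succ_right_sub_mem (D := D) (r := r) hi (by omega) hd)
    have h2 := mul_E_mem_primSub ih (Finset.mem_Icc.2 ⟨by omega, hd⟩) (by omega)
    simpa using add_mem h h2
  · intro d i hi hir hri hd ih
    have h := Jsub_le_primSub (Ev_succ_left_sub_mem (D := D) (r := r) (d := d) hi (by omega)
      (by omega))
    have h2 := mul_E_mem_primSub ih (Finset.mem_Icc.2 ⟨hi, by omega⟩) (by omega)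
    simpa using add_mem h ((D.primSub r).smul_mem (-(q : ℂ)⁻¹) h2)

/-- `F_k` annihilates the image of the root vector `E_{α_{ij}}` in `Ū` when `k` is not in
`[i, j]`. -/
lemma Ev_mul_E_mul_F_sub_mem (h0 : (q : ℂ) ≠ 0) (h2 : (q : ℂ) - (q : ℂ)⁻¹ ≠ 0) {d i k : ℕ}
    (hi : 1 ≤ i) (hd : i + d ≤ N - 1) (hk : k ∈ Finset.Icc 1 (N - 1)) (hkr : k ≠ r)
    (h : k + 1 = i ∨ k = i + d + 1) :
    D.Ev d i * D.E k * D.F k - D.Ev d i ∈ D.Jsub r := by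
  have hF : Commute (D.F k) (D.Ev d i) := commute_of_commute_E_Ev fun l hl hl' =>
    (E_mul_F_of_ne (Finset.mem_Icc.2 ⟨by omega, by omega⟩) hk (by omega)).symm
  have hEF := D.rels.2.2.2.2.1 k hk k hk
  rw [if_pos rfl] at hEF
  have hKg := Kg_mul_Ev_of_adjacent (D := D) hi hd hk h
  have hKi := Ki_mul_of_Kg_mul h0 hk hKg
  have e1 : D.Ev d i * D.Kg k = (q : ℂ) • (D.Kg k * D.Ev d i) := by
    rw [hKg, smul_smul, zpow_neg_one, mul_inv_cancel₀ h0, one_smul]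
  have e2 : D.Ev d i * D.Ki k = (q : ℂ)⁻¹ • (D.Ki k * D.Ev d i) := by
    rw [hKi, smul_smul, neg_neg, zpow_one, inv_mul_cancel₀ h0, one_smul]
  have e : D.Ev d i * D.E k * D.F k - D.Ev d i = D.F k * (D.Ev d i * D.E k) +
      ((q : ℂ) - (q : ℂ)⁻¹)⁻¹ • ((q : ℂ) • ((D.Kg k - 1) * D.Ev d i) -
        (q : ℂ)⁻¹ • ((D.Ki k - 1) * D.Ev d i)) := by
    rw [mul_assoc, sub_eq_iff_eq_add.1 hEF, mul_add, ← mul_assoc _ (D.F k), ← hF.eq,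
      mul_smul_comm, mul_sub, e1, e2]
    have h3 : D.Ev d i = ((q : ℂ) - (q : ℂ)⁻¹)⁻¹ • ((q : ℂ) • D.Ev d i - (q : ℂ)⁻¹ • D.Ev d i) := by
      rw [← sub_smul, smul_smul, inv_mul_cancel₀ h2, one_smul]
    have h4 : D.F k * (D.Ev d i * D.E k) = D.F k * D.Ev d i * D.E k := (mul_assoc _ _ _).symm
    rw [h4, sub_eq_iff_eq_add]
    generalize D.F k * D.Ev d i * D.E k = z
    rw [show z + ((q : ℂ) - (q : ℂ)⁻¹)⁻¹ • ((q : ℂ) • ((D.Kg k - 1) * D.Ev d i) -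
        (q : ℂ)⁻¹ • ((D.Ki k - 1) * D.Ev d i)) + D.Ev d i =
        z + ((q : ℂ) - (q : ℂ)⁻¹)⁻¹ • ((q : ℂ) • ((D.Kg k - 1) * D.Ev d i) -
        (q : ℂ)⁻¹ • ((D.Ki k - 1) * D.Ev d i)) + ((q : ℂ) - (q : ℂ)⁻¹)⁻¹ •
          ((q : ℂ) • D.Ev d i - (q : ℂ)⁻¹ • D.Ev d i) by rw [← h3]]
    simp only [sub_mul, one_mul, smul_sub]
    abel
  rw [e]
  refine add_mem (mul_mem_Jsub (F_mem_Jsub hk hkr) _) (Submodule.smul_mem _ _ (sub_mem ?_ ?_))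
  · exact Submodule.smul_mem _ _ (mul_mem_Jsub (Kg_sub_one_mem_Jsub hk) _)
  · exact Submodule.smul_mem _ _ (mul_mem_Jsub (Ki_sub_one_mem_Jsub hk) _)

/-- If the image of one root vector in `Ū` vanishes, then so does the image of `E_r`. -/
lemma Ev_notMem_Jsub (h0 : (q : ℂ) ≠ 0) (h2 : (q : ℂ) - (q : ℂ)⁻¹ ≠ 0)
    (hE : D.E r ∉ D.Jsub r) : ∀ d i, 1 ≤ i → i ≤ r → r ≤ i + d →
    i + d ≤ N - 1 → D.Ev d i ∉ D.Jsub r := by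
  refine phiR_induction hE ?_ ?_
  · intro d i hi hir hri hd ih hmem
    have h := sub_mem hmem (Ev_succ_right_sub_mem (r := r) hi (by omega) hd)
    rw [sub_sub_cancel] at h
    have h3 := Ev_mul_E_mul_F_sub_mem (D := D) (r := r) h0 h2 hi (by omega)
      (Finset.mem_Icc.2 ⟨by omega, hd⟩) (by omega) (Or.inr rfl)
    have h4 := sub_mem (mul_mem_Jsub h (D.F (i + d + 1))) h3
    rw [sub_sub_cancel] at h4
    exact ih h4
  · intro d i hi hir hri hd ih hmem
    have h := sub_mem hmem (Ev_succ_left_sub_mem (r := r) (d := d) hi (by omega) (by omega))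
    rw [sub_sub_cancel, Submodule.smul_mem_iff _ (neg_ne_zero.2 (inv_ne_zero h0))] at h
    have h3 := Ev_mul_E_mul_F_sub_mem (D := D) (r := r) (d := d) h0 h2 (by omega) (by omega)
      (Finset.mem_Icc.2 ⟨hi, by omega⟩) (by omega) (Or.inl rfl)
    have h4 := sub_mem (mul_mem_Jsub h (D.F i)) h3
    rw [sub_sub_cancel] at h4
    exact ih h4

end UqslData

section regularAtOne

variable {q : ℝ} (hq : Transcendental ℚ q)
include hq

lemma base_add_inv_ne_zero : (q : ℂ) + (q : ℂ)⁻¹ ≠ 0 :=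
  (inv_mem_regularAtOne hq (f := Polynomial.X ^ 2 + 1) (g := Polynomial.X) (by norm_num)
    (by have := base_ne_zero hq; simp; field_simp)).1

lemma base_sub_inv_ne_zero : (q : ℂ) - (q : ℂ)⁻¹ ≠ 0 := by
  have h0 := base_ne_zero hq
  intro h
  have h2 : Transcendental ℚ (algebraMap ℝ ℂ q) :=
    (transcendental_algebraMap_iff (algebraMap ℝ ℂ).injective).2 hq
  have h3 := transcendental_iff.1 h2 (Polynomial.X ^ 2 - 1) (by
    have : (q : ℂ) ^ 2 - 1 = ((q : ℂ) - (q : ℂ)⁻¹) * q := by field_simp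
    simp [this, h])
  have := congrArg (Polynomial.eval 0) h3
  simp at this

lemma inv_base_mem_regularAtOne : (q : ℂ)⁻¹ ∈ regularAtOne q := by
  simpa using zpow_mem_regularAtOne hq (-1)

end regularAtOne

namespace UqslData

variable {q : ℝ} {N : ℕ} (D : UqslData q N)

/-- The monomial in the generators `E_k` spelled by a list of indices. -/
def wd (l : List ℕ) : D.U := (l.map D.E).prod

/-- The lattice spanned by the monomials with a given multiset of letters. -/
def lam (m : Multiset ℕ) : Submodule (regularAtOne q) D.U :=
  Submodule.span (regularAtOne q) {x | ∃ l : List ℕ, (l : Multiset ℕ) = m ∧ x = D.wd l}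

/-- Multiples of root vectors attached to `Φ⁺_r`, with coefficients regular at `1`. -/
def rootMultiples (r : ℕ) : Set D.U :=
  {x | ∃ c ∈ regularAtOne q, ∃ d i, 1 ≤ i ∧ i ≤ r ∧ r ≤ i + d ∧ i + d ≤ N - 1 ∧
    x = c • D.Ev d i}

variable {D} {r : ℕ}

@[simp] lemma wd_nil : D.wd [] = 1 := rfl

lemma wd_append (l l' : List ℕ) : D.wd (l ++ l') = D.wd l * D.wd l' := by
  simp [wd]

@[simp] lemma wd_singleton (k : ℕ) : D.wd [k] = D.E k := by simp [wd]

lemma smul_mem_lam {m : Multiset ℕ} {x : D.U} (hx : x ∈ D.lam m) {c : ℂ}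
    (hc : c ∈ regularAtOne q) : c • x ∈ D.lam m :=
  (D.lam m).smul_mem ⟨c, hc⟩ hx

lemma wd_mem_lam (l : List ℕ) : D.wd l ∈ D.lam l := Submodule.subset_span ⟨l, rfl, rfl⟩

lemma E_mem_lam (k : ℕ) : D.E k ∈ D.lam {k} := by simpa using wd_mem_lam (D := D) [k]

lemma mul_mem_lam {m m' : Multiset ℕ} {x y : D.U} (hx : x ∈ D.lam m) (hy : y ∈ D.lam m') :
    x * y ∈ D.lam (m + m') := by
  induction hx using Submodule.span_induction with
  | mem x hx =>
    obtain ⟨l, rfl, rfl⟩ := hx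
    induction hy using Submodule.span_induction with
    | mem y hy =>
      obtain ⟨l', rfl, rfl⟩ := hy
      rw [← wd_append]
      exact wd_mem_lam _
    | zero => simp
    | add a b _ _ ha hb => rw [mul_add]; exact add_mem ha hb
    | smul c a _ ha => rw [mul_smul_comm]; exact Submodule.smul_mem _ _ ha
  | zero => simp
  | add a b _ _ ha hb => rw [add_mul]; exact add_mem ha hb
  | smul c a _ ha => rw [smul_mul_assoc]; exact Submodule.smul_mem _ _ ha

section

variable (hq : Transcendental ℚ q)
include hq

/-- Right multiplication of a root vector by a generator `E_k` with `k ≠ r`, modulo `K⁺U`. -/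
lemma exists_rootMultiples_mul_E {v : D.U} (hv : v ∈ D.rootMultiples r) {k : ℕ}
    (hk : k ∈ Finset.Icc 1 (N - 1)) (hkr : k ≠ r) :
    ∃ v' ∈ D.rootMultiples r, v * D.E k - v' ∈ D.Jsub r ∧ ∃ a ∈ regularAtOne q,
      D.E k * v + v' - v * D.E k = (((q : ℂ) - 1) * a) • (D.E k * v) := by
  have h0 := base_ne_zero hq
  have h1 := base_add_inv_ne_zero hq
  have hqi := inv_base_mem_regularAtOne hq
  have hqm := self_mem_regularAtOne q
  obtain ⟨c, hc, d, i, hi, hir, hri, hd, rfl⟩ := hv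
  obtain ⟨hk1, hk2⟩ := Finset.mem_Icc.1 hk
  have hJ (u : D.U) : D.E k * u ∈ D.Jsub r := mul_mem_Jsub (E_mem_Jsub hk hkr) u
  have hR0 : (0 : D.U) ∈ D.rootMultiples r :=
    ⟨0, zero_mem _, d, i, hi, hir, hri, hd, (zero_smul _ _).symm⟩
  have hcomm {b : ℂ} (hb : b ∈ regularAtOne q)
      (h : D.E k * D.Ev d i - D.Ev d i * D.E k =
        (((q : ℂ) - 1) * b) • (D.E k * D.Ev d i)) :
      ∃ v' ∈ D.rootMultiples r, (c • D.Ev d i) * D.E k - v' ∈ D.Jsub r ∧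
        ∃ a ∈ regularAtOne q, D.E k * (c • D.Ev d i) + v' - (c • D.Ev d i) * D.E k =
          (((q : ℂ) - 1) * a) • (D.E k * (c • D.Ev d i)) := by
    refine ⟨0, hR0, ?_, b, hb, ?_⟩
    · rw [sub_zero, smul_mul_assoc, ← sub_sub_cancel (D.E k * D.Ev d i) (D.Ev d i * D.E k), h]
      exact Submodule.smul_mem _ _ (sub_mem (hJ _) (Submodule.smul_mem _ _ (hJ _)))
    · rw [add_zero, smul_mul_assoc, mul_smul_comm, ← smul_sub, h, smul_comm]
  rcases Nat.lt_or_ge k i with hki | hki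
  · rcases Nat.lt_or_ge (k + 1) i with hki' | hki'
    · exact hcomm (zero_mem _) (by
        rw [(E_commute_Ev_of_far hi hd hk (by omega)).eq]; simp)
    · obtain rfl : i = k + 1 := by omega
      refine ⟨(-q * c : ℂ) • D.Ev (d + 1) k, ⟨_, mul_mem (neg_mem hqm) hc, d + 1, k, hk1,
        by omega, by omega, by omega, rfl⟩, ?_, -1, neg_mem (one_mem _), ?_⟩
      · have : (c • D.Ev d (k + 1)) * D.E k - (-q * c : ℂ) • D.Ev (d + 1) k =
            (q * c : ℂ) • (D.E k * D.Ev d (k + 1)) := by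
          rw [Ev, smul_mul_assoc, smul_sub, smul_smul,
            show (-q * c : ℂ) * (q : ℂ)⁻¹ = -c by field_simp]
          module
        rw [this]
        exact Submodule.smul_mem _ _ (hJ _)
      · rw [Ev, smul_mul_assoc, mul_smul_comm, smul_sub, smul_smul,
            show (-q * c : ℂ) * (q : ℂ)⁻¹ = -c by field_simp]
        module
  rcases Nat.lt_or_ge (i + d) k with hkd | hkd
  · rcases Nat.lt_or_ge (i + d + 1) k with hkd' | hkd'
    · exact hcomm (zero_mem _) (by
        rw [(E_commute_Ev_of_far hi hd hk (by omega)).eq]; simp)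
    · obtain rfl : k = i + d + 1 := by omega
      refine ⟨c • D.Ev (d + 1) i, ⟨_, hc, d + 1, i, hi, hir, by omega, by omega, rfl⟩, ?_,
        (q : ℂ)⁻¹, hqi, ?_⟩
      · rw [smul_mul_assoc, ← smul_sub, ← neg_sub]
        exact Submodule.smul_mem _ _
          (neg_mem (Ev_succ_right_sub_mem hi hkr (by omega)))
      · rw [Ev_succ_right hi (by omega), sub_mul, mul_inv_cancel₀ h0, smul_mul_assoc,
          mul_smul_comm]
        module
  obtain ⟨e, rfl⟩ : ∃ e, d = e + 1 := ⟨d - 1, by omega⟩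
  rcases Nat.eq_or_lt_of_le hki with rfl | hki
  · exact hcomm (b := (q : ℂ)⁻¹) hqi (by
      rw [E_mul_Ev_left h0 hi (by omega), smul_smul, sub_mul, sub_mul, mul_inv_cancel₀ h0,
        one_mul, one_mul, inv_mul_cancel₀ h0]
      module)
  rcases Nat.eq_or_lt_of_le hkd with rfl | hkd
  · exact hcomm (b := -1) (neg_mem (one_mem _)) (by
      rw [show i + (e + 1) = i + e + 1 by ring, Ev_mul_E_right h0 hi (by omega)]
      module)
  · exact hcomm (zero_mem _) (by
      rw [(Ev_commute_E_of_inside h0 h1 hi hd hki hkd).eq]; simp)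

/-- The root vectors attached to `Φ⁺_r` and `E_r` commute modulo `q - 1`. -/
lemma exists_E_mul_rootMultiples (hr1 : 1 ≤ r) {v : D.U} (hv : v ∈ D.rootMultiples r) :
    ∃ a ∈ regularAtOne q,
      D.E r * v - v * D.E r = (((q : ℂ) - 1) * a) • (D.E r * v) := by
  have h0 := base_ne_zero hq
  have h1 := base_add_inv_ne_zero hq
  obtain ⟨c, hc, d, i, hi, hir, hri, hd, rfl⟩ := hv
  suffices h : ∃ a ∈ regularAtOne q, D.E r * D.Ev d i - D.Ev d i * D.E r =
      (((q : ℂ) - 1) * a) • (D.E r * D.Ev d i) by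
    obtain ⟨a, ha, h⟩ := h
    exact ⟨a, ha, by rw [smul_mul_assoc, mul_smul_comm, ← smul_sub, h, smul_comm]⟩
  cases d with
  | zero =>
    obtain rfl : i = r := by omega
    exact ⟨0, zero_mem _, by simp [Ev]⟩
  | succ e =>
    rcases Nat.eq_or_lt_of_le hir with rfl | hir
    · refine ⟨(q : ℂ)⁻¹, inv_base_mem_regularAtOne hq, ?_⟩
      rw [E_mul_Ev_left h0 hi (by omega), smul_smul, sub_mul, sub_mul, mul_inv_cancel₀ h0,
        one_mul, one_mul, inv_mul_cancel₀ h0]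
      module
    rcases Nat.eq_or_lt_of_le hri with rfl | hri
    · refine ⟨-1, neg_mem (one_mem _), ?_⟩
      rw [show i + (e + 1) = i + e + 1 by ring, Ev_mul_E_right h0 hi (by omega)]
      module
    · refine ⟨0, zero_mem _, ?_⟩
      rw [(Ev_commute_E_of_inside h0 h1 hi hd hir hri).eq]; simp

/-- Monomials in the `E_k` modulo `K⁺U`. -/
lemma wd_cases (hr1 : 1 ≤ r) (l : List ℕ) (hl : ∀ k ∈ l, k ∈ Finset.Icc 1 (N - 1))
    (hne : l ≠ []) : D.wd l ∈ D.Jsub r ∨ 2 ≤ l.count r ∨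
      (l.count r = 1 ∧ ∃ v ∈ D.rootMultiples r, v ∈ D.lam l ∧ D.wd l - v ∈ D.Jsub r) := by
  induction l using List.reverseRecOn with
  | nil => exact absurd rfl hne
  | append_singleton l k ih =>
    have hk := hl k (by simp)
    rcases eq_or_ne l [] with rfl | hl0
    · rcases eq_or_ne k r with rfl | hkr
      · refine Or.inr (Or.inr ⟨by simp, D.E k, ⟨1, one_mem _, 0, k, hr1, le_rfl, by omega,
          (Finset.mem_Icc.1 hk).2, by simp [Ev]⟩, E_mem_lam k, by simp⟩)
      · exact Or.inl (by simpa using E_mem_Jsub hk hkr)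
    rw [wd_append, wd_singleton, List.count_append]
    rcases ih (fun j hj => hl j (by simp [hj])) hl0 with h | h | ⟨h1, v, hv, hvl, hJ⟩
    · exact Or.inl (mul_mem_Jsub h _)
    · exact Or.inr (Or.inl (by omega))
    · rcases eq_or_ne k r with rfl | hkr
      · exact Or.inr (Or.inl (by simp [h1]))
      · obtain ⟨v', hv', hJ', a, ha, e⟩ := exists_rootMultiples_mul_E hq hv hk hkr
        refine Or.inr (Or.inr ⟨by simp [h1, hkr], v', hv', ?_, ?_⟩)
        · have : v' = (((q : ℂ) - 1) * a - 1) • (D.E k * v) + v * D.E k := by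
            rw [sub_smul, ← e]; module
          rw [this, ← Multiset.coe_add, Multiset.coe_singleton]
          refine add_mem (smul_mem_lam ?_ (sub_mem (mul_mem
            (sub_mem (self_mem_regularAtOne q) (one_mem _)) ha) (one_mem _)))
            (mul_mem_lam hvl (E_mem_lam k))
          rw [add_comm]
          exact mul_mem_lam (E_mem_lam k) hvl
        · have := add_mem (mul_mem_Jsub hJ (D.E k)) hJ'
          rwa [sub_mul, sub_add_sub_cancel] at this

end

end UqslData

namespace UqslData

variable {q : ℝ} {N : ℕ} (D : UqslData q N)

/-- The weight of the root vector `E_{α_{i,i+d}}`. -/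
def rootWt (d i : ℕ) : ℕ → ℤ := fun k => if i ≤ k ∧ k ≤ i + d then 1 else 0

lemma rootWt_zero (i : ℕ) : rootWt 0 i = Pi.single i 1 := by
  funext k
  rcases eq_or_ne k i with rfl | h
  · simp [rootWt]
  · rw [Pi.single_eq_of_ne h, rootWt, if_neg (by omega)]

lemma rootWt_succ (d i : ℕ) : rootWt (d + 1) i = Pi.single i 1 + rootWt d (i + 1) := by
  funext k
  rcases eq_or_ne k i with rfl | h
  · simp [rootWt]
  · simp only [Pi.add_apply, Pi.single_eq_of_ne h, rootWt, zero_add]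
    exact if_congr (by omega) rfl rfl

lemma rootWt_injective {d i d' i' : ℕ} (h : rootWt d i = rootWt d' i') : d = d' ∧ i = i' := by
  have key : ∀ k, (i ≤ k ∧ k ≤ i + d) ↔ (i' ≤ k ∧ k ≤ i' + d') := fun k => by
    have := congrFun h k
    simp only [rootWt] at this
    split_ifs at this <;> tauto
  have h1 := (key i).1 ⟨le_rfl, by omega⟩
  have h2 := (key i').2 ⟨le_rfl, by omega⟩
  have h3 := (key (i + d)).1 ⟨by omega, le_rfl⟩
  have h4 := (key (i' + d')).2 ⟨by omega, le_rfl⟩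
  omega

/-- The coaction of the root lattice which defines the grading of `U`. -/
lemma exists_grading : ∃ δ : D.U →ₐ[ℂ] AddMonoidAlgebra D.U (ℕ → ℤ),
    ∀ i ∈ Finset.Icc 1 (N - 1),
      δ (D.E i) = .single (Pi.single i 1) (D.E i) ∧
      δ (D.F i) = .single (-Pi.single i 1) (D.F i) ∧
      δ (D.Kg i) = .single 0 (D.Kg i) ∧ δ (D.Ki i) = .single 0 (D.Ki i) := by
  obtain ⟨r1, r2, r3, r4, r5, r6, r7, r8, r9⟩ := D.rels
  have hc (a b : ℕ → ℤ) : a + b + a = a + a + b := by abel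
  have hc' (a b : ℕ → ℤ) : b + a + a = a + a + b := by abel
  refine D.univ (AddMonoidAlgebra D.U (ℕ → ℤ)) (fun i => .single (Pi.single i 1) (D.E i))
    (fun i => .single (-Pi.single i 1) (D.F i)) (fun i => .single 0 (D.Kg i))
    (fun i => .single 0 (D.Ki i)) ⟨?_, ?_, ?_, ?_, ?_, ?_, ?_, ?_, ?_⟩
  · intro i hi
    simp only [AddMonoidAlgebra.single_mul_single, add_zero, (r1 i hi).1, (r1 i hi).2,
      AddMonoidAlgebra.one_def, and_self]
  · intro i hi j hj
    simp only [AddMonoidAlgebra.single_mul_single, r2 i hi j hj]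
  · intro i hi j hj
    simp only [AddMonoidAlgebra.single_mul_single, r3 i hi j hj, AddMonoidAlgebra.smul_single,
      add_zero, zero_add]
  · intro i hi j hj
    simp only [AddMonoidAlgebra.single_mul_single, r4 i hi j hj, AddMonoidAlgebra.smul_single,
      add_zero, zero_add]
  · intro i hi j hj
    simp only [AddMonoidAlgebra.single_mul_single]
    rw [add_comm (-Pi.single j 1 : ℕ → ℤ), ← AddMonoidAlgebra.single_sub, r5 i hi j hj]
    split_ifs with h
    · subst h
      rw [add_neg_cancel, ← AddMonoidAlgebra.single_sub, AddMonoidAlgebra.smul_single]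
    · rw [AddMonoidAlgebra.single_zero]
  · intro i hi j hj h
    simp only [AddMonoidAlgebra.single_mul_single, AddMonoidAlgebra.smul_single]
    rw [hc, hc', ← AddMonoidAlgebra.single_sub, ← AddMonoidAlgebra.single_add, r6 i hi j hj h,
      AddMonoidAlgebra.single_zero]
  · intro i hi j hj h
    simp only [AddMonoidAlgebra.single_mul_single]
    rw [r7 i hi j hj h, add_comm]
  · intro i hi j hj h
    simp only [AddMonoidAlgebra.single_mul_single, AddMonoidAlgebra.smul_single]
    rw [hc, hc', ← AddMonoidAlgebra.single_sub, ← AddMonoidAlgebra.single_add, r8 i hi j hj h,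
      AddMonoidAlgebra.single_zero]
  · intro i hi j hj h
    simp only [AddMonoidAlgebra.single_mul_single]
    rw [r9 i hi j hj h, add_comm]

open Classical in
/-- Existence of the projections onto the weight spaces. -/
lemma exists_weight_projection (r : ℕ) : ∃ p : (ℕ → ℤ) → D.U →ₗ[ℂ] D.U,
    (∀ ν, ∀ x ∈ D.Jsub r, p ν x ∈ D.Jsub r) ∧
    (∀ ν l, (∀ k ∈ l, k ∈ Finset.Icc 1 (N - 1)) →
      p ν (D.wd l) = if (fun k => (l.count k : ℤ)) = ν then D.wd l else 0) ∧
    (∀ ν d i, 1 ≤ i → i + d ≤ N - 1 →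
      p ν (D.Ev d i) = if rootWt d i = ν then D.Ev d i else 0) := by
  obtain ⟨δ, hδ⟩ := D.exists_grading
  have hsingle (ν μ : ℕ → ℤ) (x y : D.U) (h : δ x = .single μ y) :
      (δ x).coeff ν = if μ = ν then y else 0 := by
    rw [h, AddMonoidAlgebra.coeff_single, Finsupp.single_apply]
  refine ⟨fun ν => (Finsupp.lapply ν).comp
    ((AddMonoidAlgebra.coeffLinearEquiv ℂ).toLinearMap.comp δ.toLinearMap), ?_, ?_, ?_⟩
  · intro ν x hx
    let JM : Submodule ℂ (AddMonoidAlgebra D.U (ℕ → ℤ)) :=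
      Submodule.span ℂ {y | ∃ μ, ∃ j ∈ D.Jsub r, y = .single μ j}
    have hmul : ∀ y ∈ JM, ∀ z, y * z ∈ JM := by
      intro y hy z
      induction hy using Submodule.span_induction with
      | mem y hy =>
        obtain ⟨μ, j, hj, rfl⟩ := hy
        induction z using AddMonoidAlgebra.induction_linear with
        | zero => simp
        | add a b ha hb => rw [mul_add]; exact add_mem ha hb
        | single m u =>
          rw [AddMonoidAlgebra.single_mul_single]
          exact Submodule.subset_span ⟨_, _, mul_mem_Jsub hj u, rfl⟩
      | zero => simp
      | add a b _ _ ha hb => rw [add_mul]; exact add_mem ha hb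
      | smul c a _ ha => rw [smul_mul_assoc]; exact JM.smul_mem _ ha
    have h1 : D.Jsub r ≤ JM.comap δ.toLinearMap := by
      refine Jsub_le (fun y hy u => ?_) ?_
      · simp only [Submodule.mem_comap, AlgHom.toLinearMap_apply, map_mul] at hy ⊢
        exact hmul _ hy _
      · intro y hy
        have hy' := augGens_subset_Jsub hy
        obtain ⟨i, hi, ⟨_, rfl | rfl⟩ | rfl | rfl⟩ := hy
        · exact Submodule.subset_span ⟨_, _, hy', (hδ i hi).1⟩
        · exact Submodule.subset_span ⟨_, _, hy', (hδ i hi).2.1⟩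
        · refine Submodule.subset_span ⟨0, _, hy', ?_⟩
          rw [AlgHom.toLinearMap_apply, map_sub, map_one, (hδ i hi).2.2.1,
            AddMonoidAlgebra.one_def, AddMonoidAlgebra.single_sub]
        · refine Submodule.subset_span ⟨0, _, hy', ?_⟩
          rw [AlgHom.toLinearMap_apply, map_sub, map_one, (hδ i hi).2.2.2,
            AddMonoidAlgebra.one_def, AddMonoidAlgebra.single_sub]
    have h2 : JM ≤ (D.Jsub r).comap ((Finsupp.lapply ν).comp
        (AddMonoidAlgebra.coeffLinearEquiv ℂ).toLinearMap) := by
      rw [Submodule.span_le]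
      rintro _ ⟨μ, j, hj, rfl⟩
      change (AddMonoidAlgebra.single μ j).coeff ν ∈ D.Jsub r
      rw [AddMonoidAlgebra.coeff_single, Finsupp.single_apply]
      split_ifs
      exacts [hj, zero_mem _]
    exact h2 (h1 hx)
  · intro ν l hl
    refine hsingle ν _ _ _ ?_
    induction l with
    | nil => simp only [wd_nil, map_one, AddMonoidAlgebra.one_def, List.count_nil]; rfl
    | cons k l ih =>
      rw [← List.singleton_append, wd_append, map_mul, ih fun j hj => hl j (by simp [hj]),
        wd_singleton, (hδ k (hl k (by simp))).1, AddMonoidAlgebra.single_mul_single]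
      congr 1
      funext j
      rcases eq_or_ne k j with rfl | h
      · simp [add_comm]
      · simp [h]
  · intro ν d i hi hd
    refine hsingle ν _ _ _ ?_
    induction d generalizing i with
    | zero => rw [Ev, rootWt_zero, (hδ i (Finset.mem_Icc.2 ⟨hi, hd⟩)).1]
    | succ d ih =>
      rw [Ev, map_sub, map_smul, map_mul, map_mul, ih _ (by omega) (by omega),
        (hδ i (Finset.mem_Icc.2 ⟨hi, by omega⟩)).1, AddMonoidAlgebra.single_mul_single,
        AddMonoidAlgebra.single_mul_single, add_comm (rootWt d (i + 1)), ← rootWt_succ,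
        AddMonoidAlgebra.smul_single, AddMonoidAlgebra.single_sub]

/-- A linear projection onto the span of the root vectors attached to `Φ⁺_r` which vanishes on
`K⁺U`, on `1`, and on monomials of degree at least `2` in `E_r`. -/
structure IsRootProjection (r : ℕ) (s : D.U →ₗ[ℂ] D.U) : Prop where
  map_Jsub : ∀ x ∈ D.Jsub r, s x = 0
  map_one : s 1 = 0
  map_root : ∀ v ∈ D.rootMultiples r, s v = v
  map_wd : ∀ l : List ℕ, (∀ k ∈ l, k ∈ Finset.Icc 1 (N - 1)) → 2 ≤ l.count r → s (D.wd l) = 0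

lemma exists_isRootProjection (hq : Transcendental ℚ q) {r : ℕ} (hE : D.E r ∉ D.Jsub r) :
    ∃ s : D.U →ₗ[ℂ] D.U, D.IsRootProjection r s := by
  classical
  obtain ⟨p, hpJ, hpw, hpE⟩ := D.exists_weight_projection r
  let Φ : Finset (ℕ × ℕ) := (Finset.range N ×ˢ Finset.range N).filter fun β =>
    1 ≤ β.2 ∧ β.2 ≤ r ∧ r ≤ β.2 + β.1 ∧ β.2 + β.1 ≤ N - 1
  have hΦ : ∀ {β}, β ∈ Φ ↔ 1 ≤ β.2 ∧ β.2 ≤ r ∧ r ≤ β.2 + β.1 ∧ β.2 + β.1 ≤ N - 1 := by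
    intro β
    simp only [Φ, Finset.mem_filter, Finset.mem_product, Finset.mem_range]
    omega
  have hf : ∀ β : ℕ × ℕ, ∃ f : D.U →ₗ[ℂ] ℂ, D.Jsub r ≤ LinearMap.ker f ∧
      (β ∈ Φ → f (D.Ev β.1 β.2) = 1) := by
    intro β
    by_cases hβ : β ∈ Φ
    · obtain ⟨h1, h2, h3, h4⟩ := hΦ.1 hβ
      obtain ⟨f, hf, hfJ⟩ := Submodule.exists_le_ker_of_notMem
        (Ev_notMem_Jsub (base_ne_zero hq) (base_sub_inv_ne_zero hq) hE _ _ h1 h2 h3 h4)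
      refine ⟨(f (D.Ev β.1 β.2))⁻¹ • f, fun x hx => ?_, fun _ => ?_⟩
      · rw [LinearMap.mem_ker, LinearMap.smul_apply, LinearMap.mem_ker.1 (hfJ hx), smul_zero]
      · rw [LinearMap.smul_apply, smul_eq_mul, inv_mul_cancel₀ hf]
    · exact ⟨0, by simp, fun h => absurd h hβ⟩
  choose f hfJ hf1 using hf
  let s : D.U →ₗ[ℂ] D.U := ∑ β ∈ Φ, ((f β).comp (p (rootWt β.1 β.2))).smulRight (D.Ev β.1 β.2)
  have hs (x : D.U) : s x = ∑ β ∈ Φ, f β (p (rootWt β.1 β.2) x) • D.Ev β.1 β.2 := by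
    simp [s, LinearMap.sum_apply]
  have hwd (l : List ℕ) (hl : ∀ k ∈ l, k ∈ Finset.Icc 1 (N - 1)) (hc : l.count r ≠ 1) :
      s (D.wd l) = 0 := by
    rw [hs]
    refine Finset.sum_eq_zero fun β hβ => ?_
    rw [hpw _ l hl, if_neg, map_zero, zero_smul]
    intro h
    have := congrFun h r
    obtain ⟨h1, h2, h3, h4⟩ := hΦ.1 hβ
    rw [rootWt, if_pos ⟨h2, h3⟩] at this
    exact hc (by exact_mod_cast this)
  refine ⟨s, fun x hx => ?_, ?_, ?_, fun l hl h => hwd l hl (by omega)⟩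
  · rw [hs]
    exact Finset.sum_eq_zero fun β _ => by
      rw [LinearMap.mem_ker.1 (hfJ β (hpJ _ _ hx)), zero_smul]
  · simpa using hwd [] (by simp) (by simp)
  · rintro _ ⟨c, -, d, i, h1, h2, h3, h4, rfl⟩
    have hβ : (d, i) ∈ Φ := hΦ.2 ⟨h1, h2, h3, h4⟩
    rw [map_smul, hs, Finset.sum_eq_single_of_mem _ hβ, hpE _ _ _ h1 h4, if_pos rfl, hf1 _ hβ,
      one_smul]
    intro γ _ hne
    rw [hpE _ _ _ h1 h4, if_neg, map_zero, zero_smul]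
    intro h
    obtain ⟨rfl, rfl⟩ := rootWt_injective h
    exact hne rfl

end UqslData

namespace UqslData

variable {q : ℝ} {N : ℕ} (D : UqslData q N)

/-- The lattice `lam m` modulo `K⁺U`. -/
def lamJ (r : ℕ) (m : Multiset ℕ) : Submodule (regularAtOne q) D.U :=
  D.lam m ⊔ (D.Jsub r).restrictScalars (regularAtOne q)

/-- The multiples of `q - 1` in the lattice `lam m`, modulo `K⁺U`. -/
def lamM (r : ℕ) (m : Multiset ℕ) : Submodule (regularAtOne q) D.U where
  carrier := {x | ∃ y ∈ D.lam m, x - ((q : ℂ) - 1) • y ∈ D.Jsub r}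
  zero_mem' := ⟨0, zero_mem _, by simp⟩
  add_mem' := by
    rintro a b ⟨y, hy, ha⟩ ⟨z, hz, hb⟩
    exact ⟨y + z, add_mem hy hz, by rw [smul_add, add_sub_add_comm]; exact add_mem ha hb⟩
  smul_mem' := by
    rintro ⟨c, hc⟩ a ⟨y, hy, ha⟩
    refine ⟨c • y, smul_mem_lam hy hc, ?_⟩
    change c • a - _ ∈ _
    rw [smul_comm, ← smul_sub]
    exact Submodule.smul_mem _ _ ha

variable {D} {r : ℕ} {m : Multiset ℕ}

lemma smul_mem_lamM {y : D.U} (hy : y ∈ D.lam m) : ((q : ℂ) - 1) • y ∈ D.lamM r m :=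
  ⟨y, hy, by simp⟩

lemma mem_lamM_of_mem_Jsub {x : D.U} (hx : x ∈ D.Jsub r) : x ∈ D.lamM r m :=
  ⟨0, zero_mem _, by simpa using hx⟩

lemma mem_lamJ_of_mem_Jsub {x : D.U} (hx : x ∈ D.Jsub r) : x ∈ D.lamJ r m :=
  Submodule.mem_sup_right hx

lemma mem_lamJ_of_mem_lam {x : D.U} (hx : x ∈ D.lam m) : x ∈ D.lamJ r m :=
  Submodule.mem_sup_left hx

lemma lamM_le_lamJ : D.lamM r m ≤ D.lamJ r m := by
  rintro x ⟨y, hy, hx⟩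
  rw [← sub_add_cancel x (((q : ℂ) - 1) • y)]
  exact add_mem (mem_lamJ_of_mem_Jsub hx) (mem_lamJ_of_mem_lam
    (smul_mem_lam hy (sub_mem (self_mem_regularAtOne q) (one_mem _))))

lemma mul_mem_lamM {m' : Multiset ℕ} {x y : D.U} (hx : x ∈ D.lamM r m) (hy : y ∈ D.lam m') :
    x * y ∈ D.lamM r (m + m') := by
  obtain ⟨z, hz, hx⟩ := hx
  refine ⟨z * y, mul_mem_lam hz hy, ?_⟩
  rw [← smul_mul_assoc, ← sub_mul]
  exact mul_mem_Jsub hx y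

lemma mul_mem_lamJ {m' : Multiset ℕ} {x y : D.U} (hx : x ∈ D.lamJ r m) (hy : y ∈ D.lam m') :
    x * y ∈ D.lamJ r (m + m') := by
  obtain ⟨w, hw, j, hj, rfl⟩ := Submodule.mem_sup.1 hx
  rw [add_mul]
  exact add_mem (mem_lamJ_of_mem_lam (mul_mem_lam hw hy))
    (mem_lamJ_of_mem_Jsub (mul_mem_Jsub hj y))

lemma mul_smul_mem_lamM {m' : Multiset ℕ} {x y : D.U} (hx : x ∈ D.lamJ r m)
    (hy : y ∈ D.lam m') : x * (((q : ℂ) - 1) • y) ∈ D.lamM r (m + m') := by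
  obtain ⟨w, hw, j, hj, rfl⟩ := Submodule.mem_sup.1 hx
  rw [add_mul, mul_smul_comm]
  exact add_mem (smul_mem_lamM (mul_mem_lam hw hy)) (mem_lamM_of_mem_Jsub (mul_mem_Jsub hj _))

section

variable (hq : Transcendental ℚ q)
include hq

lemma exists_wd_mul_Kg {l : List ℕ} (hl : ∀ j ∈ l, j ∈ Finset.Icc 1 (N - 1)) {k : ℕ}
    (hk : k ∈ Finset.Icc 1 (N - 1)) :
    ∃ n : ℤ, D.wd l * D.Kg k = (q : ℂ) ^ n • (D.Kg k * D.wd l) := by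
  have h0 := base_ne_zero hq
  induction l with
  | nil => exact ⟨0, by simp⟩
  | cons j l ih =>
    obtain ⟨n, hn⟩ := ih fun i hi => hl i (by simp [hi])
    refine ⟨n - cartanSL k j, ?_⟩
    rw [← List.singleton_append, wd_append, wd_singleton, mul_assoc, hn, ← mul_assoc (D.Kg k),
      Kg_mul_E hk (hl j (by simp)), smul_mul_assoc, smul_smul, ← zpow_add₀ h0, sub_add_cancel,
      mul_smul_comm, mul_assoc]

lemma mul_Kg_sub_mem_lamM (hm : ∀ j ∈ m, j ∈ Finset.Icc 1 (N - 1)) {k : ℕ}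
    (hk : k ∈ Finset.Icc 1 (N - 1)) {x : D.U} (hx : x ∈ D.lamJ r m) :
    x * D.Kg k - x ∈ D.lamM r m := by
  obtain ⟨w, hw, j, hj, rfl⟩ := Submodule.mem_sup.1 hx
  rw [add_mul, add_sub_add_comm]
  refine add_mem ?_ (mem_lamM_of_mem_Jsub (sub_mem (mul_mem_Jsub hj _) hj))
  clear hx
  induction hw using Submodule.span_induction with
  | mem w hw =>
    obtain ⟨l, rfl, rfl⟩ := hw
    obtain ⟨n, hn⟩ := exists_wd_mul_Kg hq (l := l) (fun i hi => hm i (by simpa using hi)) hk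
    obtain ⟨a, ha, e⟩ := exists_zpow_sub_one_eq hq n
    refine ⟨a • D.wd l, smul_mem_lam (wd_mem_lam l) ha, ?_⟩
    have : D.wd l * D.Kg k - D.wd l - ((q : ℂ) - 1) • (a • D.wd l) =
        (q : ℂ) ^ n • ((D.Kg k - 1) * D.wd l) := by
      rw [hn, smul_smul, ← e, sub_mul, one_mul]
      module
    rw [this]
    exact Submodule.smul_mem _ _ (mul_mem_Jsub (Kg_sub_one_mem_Jsub hk) _)
  | zero => simp
  | add a b _ _ ha hb => rw [add_mul, add_sub_add_comm]; exact add_mem ha hb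
  | smul c a _ ha => rw [smul_mul_assoc, ← smul_sub]; exact Submodule.smul_mem _ _ ha

namespace IsRootProjection

variable {s : D.U →ₗ[ℂ] D.U} (hs : D.IsRootProjection r s)
include hs

lemma wd_mem_lam (hr1 : 1 ≤ r) {l : List ℕ} (hl : ∀ k ∈ l, k ∈ Finset.Icc 1 (N - 1))
    (hne : l ≠ []) : s (D.wd l) ∈ D.lam l := by
  rcases wd_cases hq hr1 l hl hne with h | h | ⟨-, v, hv, hvl, hJ⟩
  · rw [hs.map_Jsub _ h]; exact zero_mem _
  · rw [hs.map_wd l hl h]; exact zero_mem _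
  · have := hs.map_Jsub _ hJ
    rw [map_sub, hs.map_root v hv, sub_eq_zero] at this
    rwa [this]

/-- Modulo `q - 1`, a root projection satisfies a derivation-like rule. -/
lemma exists_derivation_defect (hr1 : 1 ≤ r) {l : List ℕ}
    (hl : ∀ k ∈ l, k ∈ Finset.Icc 1 (N - 1)) (hne : l ≠ []) {k : ℕ}
    (hk : k ∈ Finset.Icc 1 (N - 1)) :
    ∃ y ∈ D.lam (l + {k}), D.E k * s (D.wd l) + s (D.wd l * D.E k) - s (D.wd l) * D.E k =
      ((q : ℂ) - 1) • y := by
  rcases wd_cases hq hr1 l hl hne with h | h | ⟨h1, v, hv, hvl, hJ⟩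
  · exact ⟨0, zero_mem _, by simp [hs.map_Jsub _ h, hs.map_Jsub _ (mul_mem_Jsub h _)]⟩
  · have h2 := hs.map_wd (l ++ [k]) (List.forall_mem_append.2 ⟨hl, List.forall_mem_singleton.2 hk⟩)
      (by rw [List.count_append]; omega)
    rw [wd_append, wd_singleton] at h2
    exact ⟨0, zero_mem _, by simp [hs.map_wd l hl h, h2]⟩
  · have hsv : s (D.wd l) = v := by
      have := hs.map_Jsub _ hJ
      rwa [map_sub, hs.map_root v hv, sub_eq_zero] at this
    have hmem : D.E k * v ∈ D.lam (l + {k}) := by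
      rw [add_comm]
      exact mul_mem_lam (E_mem_lam k) hvl
    rcases eq_or_ne k r with rfl | hkr
    · have h2 := hs.map_wd (l ++ [k]) (List.forall_mem_append.2 ⟨hl, List.forall_mem_singleton.2 hk⟩)
        (by simp [h1])
      rw [wd_append, wd_singleton] at h2
      obtain ⟨a, ha, e⟩ := exists_E_mul_rootMultiples hq hr1 hv
      exact ⟨a • (D.E k * v), smul_mem_lam hmem ha, by rw [h2, hsv, add_zero, e, mul_smul]⟩
    · obtain ⟨v', hv', hJ', a, ha, e⟩ := exists_rootMultiples_mul_E hq hv hk hkr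
      have h2 : s (D.wd l * D.E k) = v' := by
        have h3 := add_mem (mul_mem_Jsub hJ (D.E k)) hJ'
        rw [sub_mul, sub_add_sub_cancel] at h3
        have := hs.map_Jsub _ h3
        rwa [map_sub, hs.map_root v' hv', sub_eq_zero] at this
      exact ⟨a • (D.E k * v), smul_mem_lam hmem ha, by rw [h2, hsv, e, mul_smul]⟩

end IsRootProjection

end

/-- The tensors which occur in the coproduct of a monomial `w` besides `w ⊗ 1`. -/
def tensorLattice (D : UqslData q N) (r : ℕ) (m : Multiset ℕ) : AddSubgroup (D.U ⊗[ℂ] D.U) :=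
  AddSubgroup.closure {t | ∃ (m' : Multiset ℕ) (l : List ℕ), m' + l = m ∧ l ≠ [] ∧
    ∃ x ∈ D.lamJ r m', t = x ⊗ₜ D.wd l}

lemma tmul_mem_tensorLattice {m' : Multiset ℕ} {l : List ℕ} (h : m' + l = m) (hne : l ≠ [])
    {x : D.U} (hx : x ∈ D.lamJ r m') : x ⊗ₜ[ℂ] D.wd l ∈ D.tensorLattice r m :=
  AddSubgroup.subset_closure ⟨m', l, h, hne, x, hx, rfl⟩

/-- The map `x ⊗ y ↦ x * s y`. -/
def mulMap (s : D.U →ₗ[ℂ] D.U) : D.U ⊗[ℂ] D.U →ₗ[ℂ] D.U :=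
  (LinearMap.mul' ℂ D.U).comp (TensorProduct.map LinearMap.id s)

@[simp] lemma mulMap_tmul (s : D.U →ₗ[ℂ] D.U) (x y : D.U) :
    mulMap s (x ⊗ₜ y) = x * s y := rfl

section

variable (hq : Transcendental ℚ q)
include hq

lemma mul_comul_E_mem_tensorLattice (hm : ∀ j ∈ m, j ∈ Finset.Icc 1 (N - 1)) {k : ℕ}
    (hk : k ∈ Finset.Icc 1 (N - 1)) {t : D.U ⊗[ℂ] D.U} (ht : t ∈ D.tensorLattice r m) :
    t * (D.E k ⊗ₜ 1 + D.Kg k ⊗ₜ D.E k) ∈ D.tensorLattice r (m + {k}) := by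
  induction ht using AddSubgroup.closure_induction with
  | mem t ht =>
    obtain ⟨m', l, rfl, hne, x, hx, rfl⟩ := ht
    rw [mul_add, Algebra.TensorProduct.tmul_mul_tmul, Algebra.TensorProduct.tmul_mul_tmul,
      mul_one]
    rw [← wd_singleton, ← wd_append]
    refine add_mem (tmul_mem_tensorLattice (add_right_comm _ _ _) hne
      (mul_mem_lamJ hx (wd_mem_lam [k]))) (tmul_mem_tensorLattice (m' := m') ?_ (by simp) ?_)
    · rw [← Multiset.coe_add, Multiset.coe_singleton, add_assoc]
    · rw [← sub_add_cancel (x * D.Kg k) x]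
      exact add_mem (lamM_le_lamJ (mul_Kg_sub_mem_lamM hq
        (fun j hj => hm j (Multiset.mem_add.2 (Or.inl hj))) hk hx)) hx
  | zero => simp
  | add a b _ _ ha hb => rw [add_mul]; exact add_mem ha hb
  | neg a _ ha => rw [neg_mul]; exact neg_mem ha

lemma comul_wd_sub_mem_tensorLattice (l : List ℕ) (hl : ∀ k ∈ l, k ∈ Finset.Icc 1 (N - 1)) :
    Coalgebra.comul (R := ℂ) (D.wd l) - D.wd l ⊗ₜ 1 ∈ D.tensorLattice r l := by
  induction l using List.reverseRecOn with
  | nil => simp [Algebra.TensorProduct.one_def]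
  | append_singleton l k ih =>
    have hk := hl k (by simp)
    have hl' : ∀ j ∈ l, j ∈ Finset.Icc 1 (N - 1) := fun j hj => hl j (by simp [hj])
    have h := mul_comul_E_mem_tensorLattice hq (by simpa using hl') hk (ih hl')
    have e : Coalgebra.comul (R := ℂ) (D.wd (l ++ [k])) - D.wd (l ++ [k]) ⊗ₜ 1 =
        (Coalgebra.comul (R := ℂ) (D.wd l) - D.wd l ⊗ₜ 1) *
          (D.E k ⊗ₜ 1 + D.Kg k ⊗ₜ D.E k) + (D.wd l * D.Kg k) ⊗ₜ[ℂ] D.wd [k] := by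
      rw [wd_append, wd_singleton, Bialgebra.comul_mul, D.comul_E k hk, sub_mul, mul_add (_ ⊗ₜ _),
        Algebra.TensorProduct.tmul_mul_tmul, Algebra.TensorProduct.tmul_mul_tmul, one_mul,
        one_mul]
      abel
    rw [e, ← Multiset.coe_add, Multiset.coe_singleton]
    refine add_mem h (tmul_mem_tensorLattice rfl (by simp) ?_)
    have hw := mem_lamJ_of_mem_lam (r := r) (wd_mem_lam (D := D) l)
    rw [← sub_add_cancel (D.wd l * D.Kg k) (D.wd l)]
    exact add_mem (lamM_le_lamJ (mul_Kg_sub_mem_lamM hq (by simpa using hl') hk hw)) hw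

variable {s : D.U →ₗ[ℂ] D.U} (hs : D.IsRootProjection r s) (hr1 : 1 ≤ r)
include hs hr1

namespace IsRootProjection

lemma mulMap_mul_comul_E_sub_mem (hm : ∀ j ∈ m, j ∈ Finset.Icc 1 (N - 1)) {k : ℕ}
    (hk : k ∈ Finset.Icc 1 (N - 1)) {t : D.U ⊗[ℂ] D.U} (ht : t ∈ D.tensorLattice r m) :
    mulMap s (t * (D.E k ⊗ₜ 1 + D.Kg k ⊗ₜ D.E k)) - mulMap s t * D.E k ∈
      D.lamM r (m + {k}) := by
  induction ht using AddSubgroup.closure_induction with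
  | mem t ht =>
    obtain ⟨m', l, rfl, hne, x, hx, rfl⟩ := ht
    have hl : ∀ j ∈ l, j ∈ Finset.Icc 1 (N - 1) := fun j hj =>
      hm j (Multiset.mem_add.2 (Or.inr (by simpa using hj)))
    obtain ⟨y, hy, e⟩ := hs.exists_derivation_defect hq hr1 hl hne hk
    have e2 : mulMap s (x ⊗ₜ D.wd l * (D.E k ⊗ₜ 1 + D.Kg k ⊗ₜ D.E k)) -
        mulMap s (x ⊗ₜ D.wd l) * D.E k = x * (((q : ℂ) - 1) • y) +
          (x * D.Kg k - x) * s (D.wd l * D.E k) := by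
      rw [← e, mul_add, Algebra.TensorProduct.tmul_mul_tmul,
        Algebra.TensorProduct.tmul_mul_tmul, mul_one, map_add, mulMap_tmul, mulMap_tmul,
        mulMap_tmul]
      noncomm_ring
    have h1 : s (D.wd l * D.E k) ∈ D.lam (l + {k}) := by
      have := hs.wd_mem_lam hq hr1 (l := l ++ [k])
        (List.forall_mem_append.2 ⟨hl, List.forall_mem_singleton.2 hk⟩) (by simp)
      rwa [wd_append, wd_singleton, ← Multiset.coe_add, Multiset.coe_singleton] at this
    rw [e2, add_assoc]
    exact add_mem (mul_smul_mem_lamM hx hy) (mul_mem_lamM (mul_Kg_sub_mem_lamM hq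
      (fun j hj => hm j (Multiset.mem_add.2 (Or.inl hj))) hk hx) h1)
  | zero => simp
  | add a b _ _ ha hb =>
    rw [add_mul, map_add, map_add, add_mul, add_sub_add_comm]; exact add_mem ha hb
  | neg a _ ha => rw [neg_mul, map_neg, map_neg, neg_mul, ← neg_sub']; exact neg_mem ha

/-- Modulo `q - 1`, the operator `x ↦ x₁ * s x₂` acts on monomials as the degree in `E_r`. -/
lemma mulMap_comul_wd_sub_mem (l : List ℕ) (hl : ∀ k ∈ l, k ∈ Finset.Icc 1 (N - 1)) :
    mulMap s (Coalgebra.comul (R := ℂ) (D.wd l)) - (l.count r : ℂ) • D.wd l ∈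
      D.lamM r l := by
  induction l using List.reverseRecOn with
  | nil => simp [Algebra.TensorProduct.one_def, hs.map_one]
  | append_singleton l k ih =>
    have hk := hl k (by simp)
    have hl' : ∀ j ∈ l, j ∈ Finset.Icc 1 (N - 1) := fun j hj => hl j (by simp [hj])
    have hlm : ∀ j ∈ (l : Multiset ℕ), j ∈ Finset.Icc 1 (N - 1) := by simpa using hl'
    have hw := mem_lamJ_of_mem_lam (r := r) (UqslData.wd_mem_lam (D := D) l)
    have h1 := hs.mulMap_mul_comul_E_sub_mem hq hr1 hlm hk
      (comul_wd_sub_mem_tensorLattice hq (D := D) (r := r) l hl')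
    have h2 := mul_mem_lamM (ih hl') (E_mem_lam k)
    have hsE : s (D.E k) = (if k = r then 1 else 0 : ℂ) • D.E k := by
      split_ifs with h
      · subst h
        rw [one_smul]
        exact hs.map_root _ ⟨1, one_mem _, 0, k, hr1, le_rfl, le_rfl,
          (Finset.mem_Icc.1 hk).2, by simp [Ev]⟩
      · rw [zero_smul, hs.map_Jsub _ (E_mem_Jsub hk h)]
    have h3 : (D.wd l * D.Kg k - D.wd l) * s (D.E k) ∈ D.lamM r (l + {k}) := by
      refine mul_mem_lamM (mul_Kg_sub_mem_lamM hq hlm hk hw) ?_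
      rw [hsE]
      refine smul_mem_lam (E_mem_lam k) ?_
      split_ifs
      exacts [one_mem _, zero_mem _]
    have h4 := add_mem (add_mem h1 h2) h3
    rw [← Multiset.coe_singleton, Multiset.coe_add] at h4
    convert h4 using 1
    have hc : ((l ++ [k]).count r : ℂ) = l.count r + if k = r then 1 else 0 := by
      rw [List.count_append, Nat.cast_add, List.count_singleton]
      by_cases h : k = r <;> simp [h]
    rw [hc, wd_append, wd_singleton, Bialgebra.comul_mul, D.comul_E k hk, sub_mul,
      mul_add (_ ⊗ₜ _), Algebra.TensorProduct.tmul_mul_tmul,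
      Algebra.TensorProduct.tmul_mul_tmul, one_mul, one_mul, map_sub, map_sub, map_add,
      mulMap_tmul, mulMap_tmul, mulMap_tmul, hs.map_one, mul_zero, mul_zero, hsE]
    simp only [sub_mul, mul_smul_comm, smul_mul_assoc, add_smul, sub_zero,
      zero_add, smul_sub]
    abel

end IsRootProjection

end

/-- The operator `x ↦ x₁ * s x₂` preserves `K⁺U`. -/
lemma IsRootProjection.mulMap_comul_mem_Jsub {s : D.U →ₗ[ℂ] D.U} (hs : D.IsRootProjection r s)
    {t : D.U ⊗[ℂ] D.U} (ht : t ∈ D.JUU r) : mulMap s t ∈ D.Jsub r := by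
  suffices h : D.JUU r ≤ (D.Jsub r).comap (mulMap s) from h ht
  refine JUU_le fun x hx u => ⟨?_, ?_⟩
  · exact mul_mem_Jsub hx _
  · rw [Submodule.mem_comap, mulMap_tmul, hs.map_Jsub x hx, mul_zero]
    exact zero_mem _

end UqslData

namespace UqslData

variable {q : ℝ} {N : ℕ} (D : UqslData q N)

/-- The span of the monomials in the `E_k` of length at most `M` and of degree at least `2` in
`E_r`. -/
def wordSpan (r M : ℕ) : Submodule ℂ D.U :=
  Submodule.span ℂ {x | ∃ l : List ℕ, (∀ k ∈ l, k ∈ Finset.Icc 1 (N - 1)) ∧ l.length ≤ M ∧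
    2 ≤ l.count r ∧ x = D.wd l}

variable {D} {r : ℕ}

lemma wordSpan_mono {M M' : ℕ} (h : M ≤ M') : D.wordSpan r M ≤ D.wordSpan r M' :=
  Submodule.span_mono fun _ ⟨l, h1, h2, h3⟩ => ⟨l, h1, h2.trans h, h3⟩

lemma counit_eq_zero_of_mem_Jsub {x : D.U} (hx : x ∈ D.Jsub r) :
    Coalgebra.counit (R := ℂ) x = 0 := by
  suffices h : D.Jsub r ≤ LinearMap.ker (Coalgebra.counit (R := ℂ) (A := D.U)) from h hx
  refine Submodule.span_le.2 ?_
  rintro _ ⟨k, -, hk, u, rfl⟩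
  rw [SetLike.mem_coe, LinearMap.mem_ker, Bialgebra.counit_mul, hk, zero_mul]

lemma counit_eq_zero_of_mem_primSub {x : D.U} (hx : x ∈ D.primSub r) :
    Coalgebra.counit (R := ℂ) x = 0 := by
  let φ : D.U ⊗[ℂ] D.U →ₗ[ℂ] ℂ := Coalgebra.counit ∘ₗ (TensorProduct.lid ℂ D.U).toLinearMap ∘ₗ
    LinearMap.rTensor D.U Coalgebra.counit
  have hφ (a b : D.U) : φ (a ⊗ₜ b) =
      Coalgebra.counit (R := ℂ) a * Coalgebra.counit (R := ℂ) b := by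
    simp [φ]
  have h : D.JUU r ≤ LinearMap.ker φ := JUU_le fun a ha u => by
    simp [hφ, counit_eq_zero_of_mem_Jsub ha]
  have h1 : φ (Coalgebra.comul (R := ℂ) x) = Coalgebra.counit (R := ℂ) x := by
    simp [φ]
  have h2 : φ (primDefect D x) = 0 := h hx
  simpa [primDefect_apply, hφ, h1] using h2

lemma counit_wd_of_ne_nil {l : List ℕ} (hl : ∀ k ∈ l, k ∈ Finset.Icc 1 (N - 1)) (hne : l ≠ []) :
    Coalgebra.counit (R := ℂ) (D.wd l) = 0 := by
  obtain ⟨k, l, rfl⟩ := List.exists_cons_of_ne_nil hne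
  rw [wd, List.map_cons, List.prod_cons, Bialgebra.counit_mul, D.counit_E k (hl k (by simp)),
    zero_mul]

lemma counit_of_mem_wordSpan {M : ℕ} {x : D.U} (hx : x ∈ D.wordSpan r M) :
    Coalgebra.counit (R := ℂ) x = 0 := by
  suffices h : D.wordSpan r M ≤ LinearMap.ker (Coalgebra.counit (R := ℂ) (A := D.U)) from h hx
  refine Submodule.span_le.2 ?_
  rintro _ ⟨l, hl, -, h2, rfl⟩
  exact counit_wd_of_ne_nil hl (by rintro rfl; simp at h2)

lemma adjoin_le_span_wd_sup_Jsub (hq : Transcendental ℚ q) :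
    Subalgebra.toSubmodule (Algebra.adjoin ℂ
      {x : D.U | ∃ i ∈ Finset.Icc 1 (N - 1), x = D.E i ∨ x = D.Kg i ∨ x = D.Ki i}) ≤
    Submodule.span ℂ {x | ∃ l : List ℕ, (∀ k ∈ l, k ∈ Finset.Icc 1 (N - 1)) ∧ x = D.wd l} ⊔
      D.Jsub r := by
  have h0 := base_ne_zero hq
  set P := Submodule.span ℂ {x | ∃ l : List ℕ, (∀ k ∈ l, k ∈ Finset.Icc 1 (N - 1)) ∧
    x = D.wd l} ⊔ D.Jsub r with hP
  have hw : ∀ l : List ℕ, (∀ k ∈ l, k ∈ Finset.Icc 1 (N - 1)) → D.wd l ∈ P := fun l hl =>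
    Submodule.mem_sup_left (Submodule.subset_span ⟨l, hl, rfl⟩)
  have hJ : D.Jsub r ≤ P := le_sup_right
  have key : ∀ g : D.U, (∀ l : List ℕ, (∀ k ∈ l, k ∈ Finset.Icc 1 (N - 1)) → D.wd l * g ∈ P) →
      ∀ y ∈ P, y * g ∈ P := by
    intro g hg
    suffices h : P ≤ P.comap (LinearMap.mulRight ℂ g) from fun y hy => h hy
    refine sup_le (Submodule.span_le.2 ?_) fun x hx => hJ (mul_mem_Jsub hx g)
    rintro _ ⟨l, hl, rfl⟩
    exact hg l hl
  have hgroup : ∀ (g : D.U) (n : ℤ) (l : List ℕ), (∀ k ∈ l, k ∈ Finset.Icc 1 (N - 1)) →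
      g - 1 ∈ D.Jsub r → D.wd l * g = (q : ℂ) ^ n • (g * D.wd l) → D.wd l * g ∈ P := by
    intro g n l hl hg h
    rw [h, ← sub_add_cancel (g * D.wd l) (D.wd l)]
    refine Submodule.smul_mem _ _ (add_mem (hJ ?_) (hw l hl))
    have := mul_mem_Jsub hg (D.wd l)
    rwa [sub_mul, one_mul] at this
  intro b hb
  suffices h : ∀ y ∈ P, y * b ∈ P by simpa using h 1 (by simpa using hw [] (by simp))
  induction (hb : b ∈ Algebra.adjoin ℂ _) using Algebra.adjoin_induction with
  | mem g hg =>
    obtain ⟨k, hk, hg⟩ := hg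
    refine key g fun l hl => ?_
    rcases hg with rfl | rfl | rfl
    · rw [← wd_singleton, ← wd_append]
      exact hw _ (List.forall_mem_append.2 ⟨hl, List.forall_mem_singleton.2 hk⟩)
    · obtain ⟨n, hn⟩ := exists_wd_mul_Kg hq (D := D) hl hk
      exact hgroup _ n l hl (Kg_sub_one_mem_Jsub hk) hn
    · obtain ⟨n, hn⟩ := exists_wd_mul_Kg hq (D := D) hl hk
      refine hgroup _ (-n) l hl (Ki_sub_one_mem_Jsub hk) ?_
      have h1 : D.Kg k * D.wd l = (q : ℂ) ^ (-n) • (D.wd l * D.Kg k) := by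
        rw [hn, smul_smul, ← zpow_add₀ h0, neg_add_cancel, zpow_zero, one_smul]
      rw [Ki_mul_of_Kg_mul h0 hk h1, smul_smul, ← zpow_add₀ h0, add_neg_cancel, zpow_zero,
        one_smul]
  | algebraMap c =>
    intro y hy
    rw [← Algebra.commutes, ← Algebra.smul_def]
    exact Submodule.smul_mem _ _ hy
  | add a b ha hb iha ihb =>
    intro y hy
    rw [mul_add]
    exact add_mem (iha y hy) (ihb y hy)
  | mul a b ha hb iha ihb =>
    intro y hy
    rw [← mul_assoc]
    exact ihb _ (iha y hy)

lemma rootMultiples_subset_span : D.rootMultiples r ⊆ Submodule.span ℂ (EvSet D r) := by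
  rintro _ ⟨c, -, d, i, h1, h2, h3, h4, rfl⟩
  refine Submodule.smul_mem _ _ (Submodule.subset_span ⟨(i, i + d), ⟨h1, h2, h3, h4⟩, ?_⟩)
  rw [Nat.add_sub_cancel_left]

lemma span_EvSet_le_primSub (hr1 : 1 ≤ r) (hr2 : r ≤ N - 1) :
    Submodule.span ℂ (EvSet D r) ≤ D.primSub r := by
  refine Submodule.span_le.2 ?_
  rintro _ ⟨⟨i, j⟩, ⟨h1, h2, h3, h4⟩, rfl⟩
  simp only at h1 h2 h3 h4
  exact Ev_mem_primSub hr1 hr2 (j - i) i h1 h2 (by omega) (by omega)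

lemma exists_decomposition (hq : Transcendental ℚ q) (hr1 : 1 ≤ r) {x : D.U}
    (hx : x ∈ Subalgebra.toSubmodule (Algebra.adjoin ℂ
      {x : D.U | ∃ i ∈ Finset.Icc 1 (N - 1), x = D.E i ∨ x = D.Kg i ∨ x = D.Ki i}) ⊔
      D.Jsub r) :
    ∃ (M : ℕ) (c : ℂ), ∃ v ∈ Submodule.span ℂ (EvSet D r), ∃ b ∈ D.wordSpan r M,
      x - (c • 1 + v + b) ∈ D.Jsub r := by
  have hx' := sup_le (adjoin_le_span_wd_sup_Jsub hq) le_sup_right hx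
  obtain ⟨w, hw, j, hj, rfl⟩ := Submodule.mem_sup.1 hx'
  suffices h : ∃ (M : ℕ) (c : ℂ), ∃ v ∈ Submodule.span ℂ (EvSet D r), ∃ b ∈ D.wordSpan r M,
      w - (c • 1 + v + b) ∈ D.Jsub r by
    obtain ⟨M, c, v, hv, b, hb, h⟩ := h
    refine ⟨M, c, v, hv, b, hb, ?_⟩
    rw [add_sub_right_comm]
    exact add_mem h hj
  clear hx hx' hj
  induction hw using Submodule.span_induction with
  | mem w hw =>
    obtain ⟨l, hl, rfl⟩ := hw
    rcases eq_or_ne l [] with rfl | hne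
    · exact ⟨0, 1, 0, zero_mem _, 0, zero_mem _, by simp⟩
    rcases wd_cases hq hr1 l hl hne with h | h | ⟨-, v, hv, -, h⟩
    · exact ⟨0, 0, 0, zero_mem _, 0, zero_mem _, by simpa using h⟩
    · exact ⟨l.length, 0, 0, zero_mem _, D.wd l, Submodule.subset_span ⟨l, hl, le_rfl, h, rfl⟩,
        by simp⟩
    · exact ⟨0, 0, v, rootMultiples_subset_span hv, 0, zero_mem _, by simpa using h⟩
  | zero => exact ⟨0, 0, 0, zero_mem _, 0, zero_mem _, by simp⟩
  | add w w' _ _ ih ih' =>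
    obtain ⟨M, c, v, hv, b, hb, h⟩ := ih
    obtain ⟨M', c', v', hv', b', hb', h'⟩ := ih'
    refine ⟨max M M', c + c', v + v', add_mem hv hv', b + b',
      add_mem (wordSpan_mono (le_max_left _ _) hb) (wordSpan_mono (le_max_right _ _) hb'), ?_⟩
    convert add_mem h h' using 1
    module
  | smul a w _ ih =>
    obtain ⟨M, c, v, hv, b, hb, h⟩ := ih
    refine ⟨M, a * c, a • v, Submodule.smul_mem _ _ hv, a • b, Submodule.smul_mem _ _ hb, ?_⟩
    convert Submodule.smul_mem _ a h using 1
    module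

lemma IsRootProjection.mulMap_comul_sub_mem_Jsub {s : D.U →ₗ[ℂ] D.U} (hs : D.IsRootProjection r s)
    {x : D.U} (hx : x ∈ D.primSub r) :
    mulMap s (Coalgebra.comul (R := ℂ) x) - s x ∈ D.Jsub r := by
  have := hs.mulMap_comul_mem_Jsub (t := primDefect D x) hx
  simpa [primDefect_apply, mulMap_tmul, hs.map_one] using this

/-- A primitive combination of monomials of degree at least `2` in `E_r` vanishes modulo `K⁺U`. -/
lemma IsRootProjection.mem_Jsub_of_mem_wordSpan {s : D.U →ₗ[ℂ] D.U} (hs : D.IsRootProjection r s)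
    (hq : Transcendental ℚ q) (hr1 : 1 ≤ r) {M : ℕ} {b : D.U}
    (hb : b ∈ D.wordSpan r M) (hbp : b ∈ D.primSub r) : b ∈ D.Jsub r := by
  have hT : D.Jsub r ≤ (D.Jsub r).comap (mulMap s ∘ₗ Coalgebra.comul (R := ℂ)) := fun x hx =>
    hs.mulMap_comul_mem_Jsub (comul_mem_JUU hx)
  let T := (D.Jsub r).mapQ (D.Jsub r) _ hT
  let W : Set D.U := {x | ∃ l : List ℕ, (∀ k ∈ l, k ∈ Finset.Icc 1 (N - 1)) ∧ l.length ≤ M ∧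
    2 ≤ l.count r ∧ x = D.wd l}
  have hW : W.Finite := by
    refine ((List.finite_length_le (Finset.Icc 1 (N - 1)) M).image
      fun l => D.wd (l.map Subtype.val)).subset ?_
    rintro _ ⟨l, hl, hM, -, rfl⟩
    exact ⟨l.attachWith _ hl, by simpa using hM, by simp⟩
  have hsb : s b = 0 := by
    suffices h : D.wordSpan r M ≤ LinearMap.ker s from h hb
    refine Submodule.span_le.2 ?_
    rintro _ ⟨l, hl, -, h2, rfl⟩
    exact hs.map_wd l hl h2
  rw [← Submodule.Quotient.mk_eq_zero]
  refine eq_zero_of_congr_diagonal hq T ((D.Jsub r).mkQ '' W) (hW.image _) ?_ _ ?_ ?_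
  · rintro _ ⟨_, ⟨l, hl, hM, h2, rfl⟩, rfl⟩
    obtain ⟨y, hy, h⟩ := hs.mulMap_comul_wd_sub_mem hq hr1 l hl
    refine ⟨l.count r, by omega, (D.Jsub r).mkQ y, ?_, ?_⟩
    · suffices h : D.lam l ≤ (Submodule.span (regularAtOne q) ((D.Jsub r).mkQ '' W)).comap
          ((D.Jsub r).mkQ.restrictScalars (regularAtOne q)) from h hy
      refine Submodule.span_le.2 ?_
      rintro _ ⟨l', hl', rfl⟩
      have hp : l'.Perm l := Multiset.coe_eq_coe.1 hl'
      exact Submodule.subset_span ⟨_, ⟨l', fun k hk => hl k (hp.mem_iff.1 hk),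
        hp.length_eq.trans_le hM, h2.trans_eq (hp.count_eq r).symm, rfl⟩, rfl⟩
    · rw [← sub_eq_zero, ← map_smul, ← map_smul]
      change (D.Jsub r).mkQ (mulMap s (Coalgebra.comul (R := ℂ) (D.wd l))) - _ - _ = _
      rw [← map_sub, ← map_sub]
      exact (Submodule.Quotient.mk_eq_zero _).2 h
  · rw [Submodule.span_image]
    exact ⟨b, hb, rfl⟩
  · refine (Submodule.Quotient.mk_eq_zero _).2 ?_
    simpa [hsb] using hs.mulMap_comul_sub_mem_Jsub hbp

lemma mem_span_EvSet_sup_Jsub (hq : Transcendental ℚ q) (hr1 : 1 ≤ r) (hr2 : r ≤ N - 1) {x : D.U}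
    (hxp : x ∈ D.primSub r)
    (hx : x ∈ Subalgebra.toSubmodule (Algebra.adjoin ℂ
      {x : D.U | ∃ i ∈ Finset.Icc 1 (N - 1), x = D.E i ∨ x = D.Kg i ∨ x = D.Ki i}) ⊔
      D.Jsub r) :
    x ∈ Submodule.span ℂ (EvSet D r) ⊔ D.Jsub r := by
  obtain ⟨M, c, v, hv, b, hb, h⟩ := exists_decomposition hq hr1 hx
  have hvp := span_EvSet_le_primSub hr1 hr2 hv
  obtain rfl : c = 0 := by
    simpa [counit_eq_zero_of_mem_primSub hxp, counit_eq_zero_of_mem_primSub hvp,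
      counit_of_mem_wordSpan hb] using counit_eq_zero_of_mem_Jsub h
  rw [zero_smul, zero_add] at h
  have hbp : b ∈ D.primSub r := by
    have := sub_mem (sub_mem hxp hvp) (Jsub_le_primSub h)
    rwa [show x - v - (x - (v + b)) = b by abel] at this
  have hbJ : b ∈ D.Jsub r := by
    by_cases hE : D.E r ∈ D.Jsub r
    · suffices h : D.wordSpan r M ≤ D.Jsub r from h hb
      refine Submodule.span_le.2 ?_
      rintro _ ⟨_ | ⟨k, l⟩, hl, -, h2, rfl⟩
      · simp at h2
      · have hk : D.E k ∈ D.Jsub r := by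
          rcases eq_or_ne k r with rfl | hkr
          exacts [hE, E_mem_Jsub (hl k (by simp)) hkr]
        rw [wd, List.map_cons, List.prod_cons]
        exact mul_mem_Jsub hk _
    · obtain ⟨s, hs⟩ := D.exists_isRootProjection hq hE
      exact hs.mem_Jsub_of_mem_wordSpan hq hr1 hb hbp
  rw [show x = v + (b + (x - (v + b))) by abel]
  exact add_mem (Submodule.mem_sup_left hv) (Submodule.mem_sup_right (add_mem hbJ h))

lemma Ev_mem_adjoin : ∀ d i, 1 ≤ i → i + d ≤ N - 1 → D.Ev d i ∈ Algebra.adjoin ℂ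
    {x : D.U | ∃ i ∈ Finset.Icc 1 (N - 1), x = D.E i ∨ x = D.Kg i ∨ x = D.Ki i}
  | 0, i, h1, h2 => Algebra.subset_adjoin ⟨i, Finset.mem_Icc.2 ⟨h1, h2⟩, Or.inl rfl⟩
  | d + 1, i, h1, h2 => by
    have hE := Ev_mem_adjoin 0 i h1 (by omega)
    have ih := Ev_mem_adjoin d (i + 1) (by omega) (by omega)
    exact sub_mem (mul_mem hE ih) (Subalgebra.smul_mem _ (mul_mem ih hE) _)

theorem primSub_inf_adjoin_E (hq : Transcendental ℚ q) (hr1 : 1 ≤ r) (hr2 : r ≤ N - 1) :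
    D.primSub r ⊓ (Subalgebra.toSubmodule (Algebra.adjoin ℂ
        {x : D.U | ∃ i ∈ Finset.Icc 1 (N - 1), x = D.E i ∨ x = D.Kg i ∨ x = D.Ki i}) ⊔
        D.Jsub r) =
      Submodule.span ℂ (EvSet D r) ⊔ D.Jsub r := by
  refine le_antisymm (fun x hx => mem_span_EvSet_sup_Jsub hq hr1 hr2 hx.1 hx.2)
    (le_inf (sup_le (span_EvSet_le_primSub hr1 hr2) Jsub_le_primSub)
      (sup_le_sup_right (Submodule.span_le.2 ?_) _))
  rintro _ ⟨⟨i, j⟩, ⟨h1, h2, h3, h4⟩, rfl⟩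
  simp only at h1 h2 h3 h4
  exact Ev_mem_adjoin (j - i) i h1 (by omega)

end UqslData

namespace UqslData

variable {q : ℝ} {N : ℕ} (D : UqslData q N)

/-- The Chevalley involution exchanging `E_i` with `F_i` and `K_i` with `K_i⁻¹`. -/
def IsChevalley (ω : D.U →ₐ[ℂ] D.U) : Prop :=
  ∀ i ∈ Finset.Icc 1 (N - 1),
    ω (D.E i) = D.F i ∧ ω (D.F i) = D.E i ∧ ω (D.Kg i) = D.Ki i ∧ ω (D.Ki i) = D.Kg i

lemma exists_isChevalley (h0 : (q : ℂ) ≠ 0) : ∃ ω : D.U →ₐ[ℂ] D.U, D.IsChevalley ω := by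
  obtain ⟨h1, h2, h3, h4, h5, h6, h7, h8, h9⟩ := D.rels
  refine D.univ D.U D.F D.E D.Ki D.Kg ⟨fun i hi => (h1 i hi).symm, fun i hi j hj => ?_,
    fun i hi j hj => ?_, fun i hi j hj => ?_, fun i hi j hj => ?_, h8, h9, h6, h7⟩
  · have e1 : D.Kg j * D.Ki i = D.Ki i * D.Kg j := by
      simpa using (Ki_mul_of_Kg_mul h0 (n := 0) (x := D.Kg j) hi
        (by simpa using h2 i hi j hj)).symm
    simpa using (Ki_mul_of_Kg_mul h0 (n := 0) (x := D.Ki i) hj (by simpa using e1)).symm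
  · simpa using Ki_mul_of_Kg_mul h0 hi (h4 i hi j hj)
  · exact Ki_mul_of_Kg_mul h0 hi (h3 i hi j hj)
  · rw [← neg_sub, h5 j hj i hi]
    by_cases h : i = j
    · subst h
      rw [if_pos rfl, if_pos rfl, ← smul_neg, neg_sub]
    · rw [if_neg h, if_neg (Ne.symm h), neg_zero]

variable {D} {r : ℕ}

lemma Fv_succ_right {d i : ℕ} (hi : 1 ≤ i) (hd : i + d + 1 ≤ N - 1) :
    D.Fv (d + 1) i =
      D.F (i + d + 1) * D.Fv d i - (q : ℂ)⁻¹ • (D.Fv d i * D.F (i + d + 1)) := by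
  induction d generalizing i with
  | zero => rfl
  | succ d ih =>
    have hc : D.F i * D.F (i + (d + 1) + 1) = D.F (i + (d + 1) + 1) * D.F i :=
      D.rels.2.2.2.2.2.2.2.2 _ (Finset.mem_Icc.2 ⟨by omega, by omega⟩) _
        (Finset.mem_Icc.2 ⟨by omega, by omega⟩) (by omega)
    rw [Fv, ih (by omega) (by omega), Fv, show i + 1 + d + 1 = i + (d + 1) + 1 by omega]
    have a1 (y : D.U) : D.F i * (D.F (i + (d + 1) + 1) * y) =
        D.F (i + (d + 1) + 1) * (D.F i * y) := by rw [← mul_assoc, hc, mul_assoc]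
    simp only [mul_sub, sub_mul, mul_smul_comm, smul_mul_assoc, smul_sub, mul_assoc]
    rw [a1, ← hc]
    module

namespace IsChevalley

variable {ω : D.U →ₐ[ℂ] D.U} (hω : D.IsChevalley ω)

include hω

lemma apply_apply (x : D.U) : ω (ω x) = x := by
  suffices h : ω.comp ω = AlgHom.id ℂ D.U from DFunLike.congr_fun h x
  refine AlgHom.ext_of_adjoin_eq_top D.gen ?_
  rintro _ ⟨i, hi, rfl | rfl | rfl | rfl⟩ <;> simp [hω i hi]

lemma comul_apply (x : D.U) : Coalgebra.comul (R := ℂ) (ω x) =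
    TensorProduct.comm ℂ D.U D.U
      (TensorProduct.map ω.toLinearMap ω.toLinearMap (Coalgebra.comul (R := ℂ) x)) := by
  suffices h : (Bialgebra.comulAlgHom ℂ D.U).comp ω =
      ((Algebra.TensorProduct.comm ℂ D.U D.U).toAlgHom.comp
        (Algebra.TensorProduct.map ω ω)).comp (Bialgebra.comulAlgHom ℂ D.U) from
    DFunLike.congr_fun h x
  refine AlgHom.ext_of_adjoin_eq_top D.gen ?_
  rintro _ ⟨i, hi, rfl | rfl | rfl | rfl⟩ <;>
  simp [hω i hi, D.comul_E i hi, D.comul_F i hi, D.comul_Kg i hi, D.comul_Ki i hi, add_comm]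

lemma mem_Jsub {x : D.U} (hx : x ∈ D.Jsub r) : ω x ∈ D.Jsub r := by
  suffices h : D.Jsub r ≤ (D.Jsub r).comap ω.toLinearMap from h hx
  refine Jsub_le (fun x hx u => ?_) ?_
  · simpa using mul_mem_Jsub hx (ω u)
  · rintro _ ⟨i, hi, ⟨h, rfl | rfl⟩ | rfl | rfl⟩
    · simpa [hω i hi] using F_mem_Jsub hi h
    · simpa [hω i hi] using E_mem_Jsub hi h
    · simpa [hω i hi] using Ki_sub_one_mem_Jsub hi
    · simpa [hω i hi] using Kg_sub_one_mem_Jsub hi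

lemma mem_primSub {x : D.U} (hx : x ∈ D.primSub r) : ω x ∈ D.primSub r := by
  let φ : D.U ⊗[ℂ] D.U →ₗ[ℂ] D.U ⊗[ℂ] D.U := (TensorProduct.comm ℂ D.U D.U).toLinearMap ∘ₗ
    TensorProduct.map ω.toLinearMap ω.toLinearMap
  have hφ : D.JUU r ≤ (D.JUU r).comap φ := JUU_le fun a ha u =>
    ⟨tmul_mem_JUU_right (hω.mem_Jsub ha) _, tmul_mem_JUU_left (hω.mem_Jsub ha) _⟩
  have h : primDefect D (ω x) = φ (primDefect D x) := by
    simp only [primDefect_apply, hω.comul_apply, map_sub]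
    simp [φ, sub_right_comm]
  change primDefect D (ω x) ∈ D.JUU r
  rw [h]
  exact hφ hx

/-- Modulo `K⁺U`, the involution maps `E_β` to a multiple of `F_β`. -/
lemma exists_Ev_sub_smul_Fv_mem (h0 : (q : ℂ) ≠ 0) (hr1 : 1 ≤ r) (hr2 : r ≤ N - 1) :
    ∀ d i, 1 ≤ i → i ≤ r → r ≤ i + d → i + d ≤ N - 1 →
      ∃ c : ℂ, c ≠ 0 ∧ ω (D.Ev d i) - c • D.Fv d i ∈ D.Jsub r := by
  refine phiR_induction ⟨1, one_ne_zero, ?_⟩ ?_ ?_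
  · simp [Ev, Fv, hω r (Finset.mem_Icc.2 ⟨hr1, hr2⟩)]
  · rintro d i hi hir hri hd ⟨c, hc, ih⟩
    have hk : i + d + 1 ∈ Finset.Icc 1 (N - 1) := Finset.mem_Icc.2 ⟨by omega, hd⟩
    refine ⟨-((q : ℂ) * c), neg_ne_zero.2 (mul_ne_zero h0 hc), ?_⟩
    have h1 := hω.mem_Jsub (Ev_succ_right_sub_mem (D := D) (r := r) hi (by omega) hd)
    have h2 := mul_mem_Jsub ih (D.F (i + d + 1))
    have h3 := Submodule.smul_mem _ ((q : ℂ) * c)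
      (mul_mem_Jsub (F_mem_Jsub (r := r) hk (by omega)) (D.Fv d i))
    rw [map_sub, map_mul, (hω _ hk).1] at h1
    rw [Fv_succ_right hi hd]
    convert add_mem (add_mem h1 h2) h3 using 1
    simp only [sub_mul, smul_sub, smul_mul_assoc, smul_smul]
    rw [show -((q : ℂ) * c) * (q : ℂ)⁻¹ = -c by field_simp]
    module
  · rintro d i hi hir hri hd ⟨c, hc, ih⟩
    have hk : i ∈ Finset.Icc 1 (N - 1) := Finset.mem_Icc.2 ⟨hi, by omega⟩
    refine ⟨-((q : ℂ)⁻¹ * c), neg_ne_zero.2 (mul_ne_zero (inv_ne_zero h0) hc), ?_⟩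
    have h1 := hω.mem_Jsub
      (Ev_succ_left_sub_mem (D := D) (r := r) (d := d) hi (by omega) (by omega))
    have h2 := Submodule.smul_mem _ (-(q : ℂ)⁻¹) (mul_mem_Jsub ih (D.F i))
    have h3 := Submodule.smul_mem _ (-((q : ℂ)⁻¹ * c * (q : ℂ)⁻¹))
      (mul_mem_Jsub (F_mem_Jsub (r := r) hk (by omega)) (D.Fv d (i + 1)))
    rw [map_sub, map_smul, map_mul, (hω _ hk).1] at h1
    rw [Fv]
    convert add_mem (add_mem h1 h2) h3 using 1
    simp only [sub_mul, smul_sub, smul_mul_assoc]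
    module

lemma mem_span_FvSet_sup_Jsub (h0 : (q : ℂ) ≠ 0) (hr1 : 1 ≤ r) (hr2 : r ≤ N - 1) {x : D.U}
    (hx : x ∈ Submodule.span ℂ (EvSet D r) ⊔ D.Jsub r) :
    ω x ∈ Submodule.span ℂ (FvSet D r) ⊔ D.Jsub r := by
  suffices h : Submodule.span ℂ (EvSet D r) ⊔ D.Jsub r ≤
      (Submodule.span ℂ (FvSet D r) ⊔ D.Jsub r).comap ω.toLinearMap from h hx
  refine sup_le (Submodule.span_le.2 ?_) fun x hx => Submodule.mem_sup_right (hω.mem_Jsub hx)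
  rintro _ ⟨⟨i, j⟩, hp, rfl⟩
  obtain ⟨h1, h2, h3, h4⟩ := id hp
  simp only at h1 h2 h3 h4
  obtain ⟨c, -, h⟩ := hω.exists_Ev_sub_smul_Fv_mem h0 hr1 hr2 (j - i) i h1 h2 (by omega)
    (by omega)
  have h5 : c • D.Fv (j - i) i ∈ Submodule.span ℂ (FvSet D r) :=
    Submodule.smul_mem _ _ (Submodule.subset_span ⟨(i, j), hp, rfl⟩)
  simpa using add_mem (Submodule.mem_sup_right (T := D.Jsub r) h) (Submodule.mem_sup_left h5)

lemma mem_span_EvSet_sup_Jsub (h0 : (q : ℂ) ≠ 0) (hr1 : 1 ≤ r) (hr2 : r ≤ N - 1) {x : D.U}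
    (hx : x ∈ Submodule.span ℂ (FvSet D r) ⊔ D.Jsub r) :
    ω x ∈ Submodule.span ℂ (EvSet D r) ⊔ D.Jsub r := by
  suffices h : Submodule.span ℂ (FvSet D r) ⊔ D.Jsub r ≤
      (Submodule.span ℂ (EvSet D r) ⊔ D.Jsub r).comap ω.toLinearMap from h hx
  refine sup_le (Submodule.span_le.2 ?_) fun x hx => Submodule.mem_sup_right (hω.mem_Jsub hx)
  rintro _ ⟨⟨i, j⟩, hp, rfl⟩
  obtain ⟨h1, h2, h3, h4⟩ := id hp
  simp only at h1 h2 h3 h4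
  obtain ⟨c, hc, h⟩ := hω.exists_Ev_sub_smul_Fv_mem h0 hr1 hr2 (j - i) i h1 h2 (by omega)
    (by omega)
  have h5 := Submodule.smul_mem _ (-c⁻¹) (hω.mem_Jsub h)
  have h6 : c⁻¹ • D.Ev (j - i) i ∈ Submodule.span ℂ (EvSet D r) :=
    Submodule.smul_mem _ _ (Submodule.subset_span ⟨(i, j), hp, rfl⟩)
  rw [map_sub, map_smul, hω.apply_apply, smul_sub, smul_smul, neg_mul, inv_mul_cancel₀ hc] at h5
  change ω (D.Fv (j - i) i) ∈ Submodule.span ℂ (EvSet D r) ⊔ D.Jsub r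
  convert add_mem (Submodule.mem_sup_right h5) (Submodule.mem_sup_left h6) using 1
  module

lemma mem_adjoin_sup_Jsub {s t : Set D.U} (hst : ∀ x ∈ s, ω x ∈ t) {x : D.U}
    (hx : x ∈ Subalgebra.toSubmodule (Algebra.adjoin ℂ s) ⊔ D.Jsub r) :
    ω x ∈ Subalgebra.toSubmodule (Algebra.adjoin ℂ t) ⊔ D.Jsub r := by
  obtain ⟨a, ha, j, hj, rfl⟩ := Submodule.mem_sup.1 hx
  rw [map_add]
  refine add_mem (Submodule.mem_sup_left ?_) (Submodule.mem_sup_right (hω.mem_Jsub hj))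
  have h : Algebra.adjoin ℂ s ≤ (Algebra.adjoin ℂ t).comap ω :=
    Algebra.adjoin_le fun x hx => Algebra.subset_adjoin (hst x hx)
  exact h ha

end IsChevalley

theorem primSub_inf_adjoin_F (hq : Transcendental ℚ q) (hr1 : 1 ≤ r) (hr2 : r ≤ N - 1) :
    D.primSub r ⊓ (Subalgebra.toSubmodule (Algebra.adjoin ℂ
        {x : D.U | ∃ i ∈ Finset.Icc 1 (N - 1), x = D.F i ∨ x = D.Kg i ∨ x = D.Ki i}) ⊔
        D.Jsub r) =
      Submodule.span ℂ (FvSet D r) ⊔ D.Jsub r := by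
  have h0 := base_ne_zero hq
  obtain ⟨ω, hω⟩ := D.exists_isChevalley h0
  have hE := primSub_inf_adjoin_E (D := D) hq hr1 hr2
  ext x
  constructor
  · rintro ⟨hxp, hx⟩
    rw [← hω.apply_apply x]
    refine hω.mem_span_FvSet_sup_Jsub h0 hr1 hr2 (hE.le ⟨hω.mem_primSub hxp, ?_⟩)
    refine hω.mem_adjoin_sup_Jsub ?_ hx
    rintro _ ⟨i, hi, rfl | rfl | rfl⟩ <;> exact ⟨i, hi, by simp [hω i hi]⟩
  · intro hx
    obtain ⟨hxp, hx⟩ := hE.ge (hω.mem_span_EvSet_sup_Jsub h0 hr1 hr2 hx)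
    rw [← hω.apply_apply x]
    refine ⟨hω.mem_primSub hxp, hω.mem_adjoin_sup_Jsub ?_ hx⟩
    rintro _ ⟨i, hi, rfl | rfl | rfl⟩ <;> exact ⟨i, hi, by simp [hω i hi]⟩

end UqslData

/-- Lemma `EFprim`.  The primitive elements of the subcoalgebras
`Ū₊` and `Ū₋` of `Ū = U/K⁺U` (the images of `U_q(b⁺)` and `U_q(b⁻)`) are exactly
`P(Ū₊) = span{E_{β'} | β' ∈ Φ⁺_r}` and `P(Ū₋) = span{F_β | β ∈ Φ⁺_r}`.
We state this on representatives: the preimage in `U` of `P(Ū₊)` (resp. `P(Ū₋)`) is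
`span{E_{β'}} + K⁺U` (resp. `span{F_β} + K⁺U`). -/
theorem primitives_of_Ubar_plus_minus
    (q : ℝ) (hq : Transcendental ℚ q)
    (N r : ℕ) (hN : 2 ≤ N) (hr1 : 1 ≤ r) (hr2 : r ≤ N - 1)
    (D : UqslData q N) :
    (Submodule.comap (primDefect D) (D.JUU r) ⊓
        (Subalgebra.toSubmodule (Algebra.adjoin ℂ
          {x : D.U | ∃ i ∈ Finset.Icc 1 (N - 1), x = D.E i ∨ x = D.Kg i ∨ x = D.Ki i}) ⊔
          D.Jsub r) =
      Submodule.span ℂ (EvSet D r) ⊔ D.Jsub r) ∧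
    (Submodule.comap (primDefect D) (D.JUU r) ⊓
        (Subalgebra.toSubmodule (Algebra.adjoin ℂ
          {x : D.U | ∃ i ∈ Finset.Icc 1 (N - 1), x = D.F i ∨ x = D.Kg i ∨ x = D.Ki i}) ⊔
          D.Jsub r) =
      Submodule.span ℂ (FvSet D r) ⊔ D.Jsub r) :=
  ⟨UqslData.primSub_inf_adjoin_E hq hr1 hr2, UqslData.primSub_inf_adjoin_F hq hr1 hr2⟩
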